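/- arXiv:math/0504177 — 6 statements merged into one kernel-verified Lean document; each statement's English description precedes it below -/
import Mathlib

section
/- Let R be a commutative ℂ-algebra together with a ℂ-algebra homomorphism φ : ℂ[y₁,…,yₙ] → R, set gᵢ = φ(yᵢ), and assume R is flat as a module over ℂ[y₁,…,yₙ]. Let m ≥ 1 and let P ∈ R[T₁,…,Tₙ] be a polynomial which is homogeneous of degree m in the variables T₁,…,Tₙ and satisfies P(g₁,…,gₙ) = 0 in R (substituting Tᵢ = gᵢ). Then there exist polynomials P_{i,j} ∈ R[T₁,…,Tₙ], indexed by ordered pairs i ≠ j, each homogeneous of degree m − 1 in T₁,…,Tₙ, such that P = Σ_{i≠j} (gᵢ·Tⱼ − gⱼ·Tᵢ)·P_{i,j}. -/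
open MvPolynomial

/-- The degree `d + 1` part of the ideal of `R[T]` generated by the `gᵢ Tⱼ - gⱼ Tᵢ`, as the span of
the products of these generators with homogeneous polynomials of degree `d`. -/
noncomputable def koszulSpan {σ R : Type*} [CommRing R] (g : σ → R) (d : ℕ) : Submodule R (MvPolynomial σ R) :=
  Submodule.span R
    {p | ∃ i j q, q.IsHomogeneous d ∧ p = (C (g i) * X j - C (g j) * X i) * q}

theorem exists_eq_sum_of_mem_koszulSpan {σ R : Type*} [Fintype σ] [CommRing R] {g : σ → R} {d : ℕ}
    {p : MvPolynomial σ R} (hp : p ∈ koszulSpan g d) :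
    ∃ q : σ → σ → MvPolynomial σ R, (∀ i j, (q i j).IsHomogeneous d) ∧
      p = ∑ i, ∑ j, (C (g i) * X j - C (g j) * X i) * q i j := by
  classical
  induction hp using Submodule.span_induction with
  | mem p hp =>
    obtain ⟨i, j, q, hq, rfl⟩ := hp
    refine ⟨fun a b => if a = i then if b = j then q else 0 else 0, fun a b => ?_, ?_⟩
    · dsimp only
      split_ifs
      exacts [hq, isHomogeneous_zero _ _ _, isHomogeneous_zero _ _ _]
    · rw [Finset.sum_eq_single i (by simp +contextual) (by simp),
        Finset.sum_eq_single j (by simp +contextual) (by simp)]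
      simp
  | zero => exact ⟨0, fun _ _ => isHomogeneous_zero _ _ _, by simp⟩
  | add p p' _ _ hp hp' =>
    obtain ⟨q, hq, rfl⟩ := hp
    obtain ⟨q', hq', rfl⟩ := hp'
    exact ⟨q + q', fun i j => (hq i j).add (hq' i j), by
      simp [mul_add, Finset.sum_add_distrib]⟩
  | smul r p _ hp =>
    obtain ⟨q, hq, rfl⟩ := hp
    refine ⟨r • q, fun i j => (homogeneousSubmodule σ R d).smul_mem r (hq i j), ?_⟩
    simp [Finset.smul_sum]

theorem map_mem_koszulSpan {σ R S : Type*} [CommRing R] [CommRing S] (f : R →+* S) {g : σ → R}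
    {d : ℕ} {p : MvPolynomial σ R} (hp : p ∈ koszulSpan g d) :
    map f p ∈ koszulSpan (fun i => f (g i)) d := by
  induction hp using Submodule.span_induction with
  | mem p hp =>
    obtain ⟨i, j, q, hq, rfl⟩ := hp
    exact Submodule.subset_span ⟨i, j, map f q, hq.map f, by simp⟩
  | zero => simp
  | add p p' _ _ hp hp' => simpa using add_mem hp hp'
  | smul r p _ hp => simpa [smul_eq_C_mul] using Submodule.smul_mem _ (f r) hp

theorem Finsupp.exists_lt_of_degree_eq {σ : Type*} {α β : σ →₀ ℕ} (h : α.degree = β.degree)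
    (hne : α ≠ β) : ∃ i, β i < α i := by
  by_contra! hle
  obtain ⟨γ, rfl⟩ := exists_add_of_le (show α ≤ β from hle)
  have hγ : γ.degree = 0 := by simpa using h
  simp [(Finsupp.degree_eq_zero_iff γ).1 hγ] at hne

theorem monomial_monomial_sub_mem_koszulSpan {σ k : Type*} [CommRing k] {d : ℕ}
    {α α' β β' : σ →₀ ℕ} (hα : α.degree = d + 1) (hα' : α'.degree = d + 1)
    (h : α + β = α' + β') :
    monomial α (monomial β (1 : k)) - monomial α' (monomial β' 1) ∈
      koszulSpan (X : σ → MvPolynomial σ k) d := by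
  classical
  induction hδ : α - α' using WellFoundedLT.induction generalizing α β with
  | ind δ ih =>
  by_cases hne : α = α'
  · subst hne
    obtain rfl := add_left_cancel h
    simp
  obtain ⟨i, hi⟩ := Finsupp.exists_lt_of_degree_eq (hα.trans hα'.symm) hne
  obtain ⟨j, hj⟩ := Finsupp.exists_lt_of_degree_eq (hα'.trans hα.symm) (Ne.symm hne)
  have hβj : 1 ≤ β j := by
    have := DFunLike.congr_fun h j
    simp only [Finsupp.add_apply] at this
    omega
  obtain ⟨α₀, rfl⟩ := exists_add_of_le (Finsupp.single_le_iff.2 (show 1 ≤ α i by omega))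
  obtain ⟨β₀, rfl⟩ := exists_add_of_le (Finsupp.single_le_iff.2 hβj)
  have hij : i ≠ j := by rintro rfl; omega
  have hdeg : α₀.degree = d := by simpa [add_comm 1] using hα
  have hlt : Finsupp.single j 1 + α₀ - α' < δ := by
    subst hδ
    refine lt_of_le_of_ne (fun l => ?_) fun he => ?_
    · simp only [Finsupp.tsub_apply, Finsupp.add_apply, Finsupp.single_apply] at hj ⊢
      split_ifs at hj ⊢ <;> subst_vars <;> omega
    · have := DFunLike.congr_fun he i
      simp [hij] at this hi
      omega
  have hrec := ih _ hlt (α := Finsupp.single j 1 + α₀) (β := Finsupp.single i 1 + β₀)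
    (by simp [hdeg, add_comm]) (by rw [← h]; abel) rfl
  rw [← sub_add_sub_cancel _ (monomial (Finsupp.single j 1 + α₀)
    (monomial (Finsupp.single i 1 + β₀) (1 : k)))]
  refine add_mem (Submodule.subset_span ⟨j, i, monomial α₀ (monomial β₀ 1),
    isHomogeneous_monomial _ hdeg, ?_⟩) hrec
  simp [sub_mul, X, C_mul_monomial, monomial_mul]

theorem mem_koszulSpan_of_eval_X_eq_zero {σ k : Type*} [CommRing k] {d : ℕ}
    {Q : MvPolynomial σ (MvPolynomial σ k)} (hQ : Q.IsHomogeneous (d + 1)) (h : eval X Q = 0) :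
    Q ∈ koszulSpan (X : σ → MvPolynomial σ k) d := by
  classical
  let s : MvPolynomial σ k →ₗ[k] MvPolynomial σ (MvPolynomial σ k) :=
    (basisMonomials σ k).constr k fun γ =>
      if h : ∃ p : (σ →₀ ℕ) × (σ →₀ ℕ), p.1.degree = d + 1 ∧ p.1 + p.2 = γ then
        monomial h.choose.1 (monomial h.choose.2 1) else 0
  have s_monomial (γ : σ →₀ ℕ) (c : k) : s (monomial γ c) = c • s (monomial γ 1) := by
    rw [← map_smul, smul_monomial, smul_eq_mul, mul_one]
  have key (α : σ →₀ ℕ) (hα : α.degree = d + 1) (a : MvPolynomial σ k) :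
      monomial α a - s (a * monomial α 1) ∈ koszulSpan (X : σ → MvPolynomial σ k) d := by
    induction a using MvPolynomial.induction_on' with
    | monomial β c =>
      have hex : ∃ p : (σ →₀ ℕ) × (σ →₀ ℕ), p.1.degree = d + 1 ∧ p.1 + p.2 = β + α :=
        ⟨(α, β), hα, add_comm _ _⟩
      have hs : s (monomial (β + α) 1) = monomial hex.choose.1 (monomial hex.choose.2 1) := by
        have := (basisMonomials σ k).constr_basis k (fun γ =>
          if h : ∃ p : (σ →₀ ℕ) × (σ →₀ ℕ), p.1.degree = d + 1 ∧ p.1 + p.2 = γ then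
            monomial h.choose.1 (monomial h.choose.2 (1 : k)) else 0) (β + α)
        rw [coe_basisMonomials] at this
        exact this.trans (dif_pos hex)
      have hc : monomial α (monomial β c) = (C c : MvPolynomial σ k) • monomial α (monomial β (1 : k)) := by
        simp [smul_monomial, C_mul_monomial]
      rw [monomial_mul, mul_one, s_monomial, hs, hc, ← algebraMap_eq,
        ← algebraMap_smul (MvPolynomial σ k) c (monomial hex.choose.1 _), ← smul_sub]
      exact Submodule.smul_mem _ _ (monomial_monomial_sub_mem_koszulSpan hα hex.choose_spec.1
        ((add_comm _ _).trans hex.choose_spec.2.symm))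
    | add p q hp hq =>
      rw [map_add, add_mul, map_add, add_sub_add_comm]
      exact add_mem hp hq
  have hsum : eval X Q = ∑ α ∈ Q.support, coeff α Q * monomial α 1 := by
    simp_rw [eval_eq, prod_X_pow_eq_monomial]
  have hs : Q - s (eval X Q) = ∑ α ∈ Q.support,
      (monomial α (coeff α Q) - s (coeff α Q * monomial α 1)) := by
    rw [Finset.sum_sub_distrib, ← as_sum, hsum, map_sum]
  rw [h, map_zero, sub_zero] at hs
  rw [hs]
  refine sum_mem fun α hα => key α ?_ _
  rw [Finsupp.degree_eq_weight_one]
  exact hQ (mem_support_iff.1 hα)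

theorem mem_koszulSpan_of_flat {σ k R : Type*} [CommRing k] [CommRing R]
    [Algebra (MvPolynomial σ k) R] [Module.Flat (MvPolynomial σ k) R] {d : ℕ}
    {P : MvPolynomial σ R} (hP : P.IsHomogeneous (d + 1))
    (h : eval (fun i => algebraMap (MvPolynomial σ k) R (X i)) P = 0) :
    P ∈ koszulSpan (fun i => algebraMap (MvPolynomial σ k) R (X i)) d := by
  have hrel : ∑ α : P.support, (monomial α.1 (1 : k)) • coeff α.1 P = 0 := by
    rw [← h, eval_eq, Finset.sum_coe_sort P.support (fun α => monomial α (1 : k) • coeff α P)]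
    refine Finset.sum_congr rfl fun α _ => ?_
    simp [Algebra.smul_def, mul_comm, ← prod_X_pow_eq_monomial]
  have htriv : Module.IsTrivialRelation (fun α : P.support => monomial α.1 (1 : k))
      (fun α : P.support => coeff α.1 P) :=
    Module.Flat.isTrivialRelation_of_sum_smul_eq_zero hrel
  obtain ⟨_, a, z, hz, ha⟩ := htriv
  have hPz : P = ∑ l, z l • map (algebraMap (MvPolynomial σ k) R)
      (∑ α : P.support, monomial α.1 (a α l)) := by
    conv_lhs => rw [as_sum P, ← Finset.sum_coe_sort]
    simp_rw [hz, map_sum, Finset.smul_sum]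
    rw [Finset.sum_comm]
    simp [Algebra.smul_def, mul_comm, C_mul_monomial]
  rw [hPz]
  refine sum_mem fun l _ => Submodule.smul_mem _ _ (map_mem_koszulSpan _
    (mem_koszulSpan_of_eval_X_eq_zero ?_ ?_))
  · refine IsHomogeneous.sum _ _ _ fun α _ => isHomogeneous_monomial _ ?_
    rw [Finsupp.degree_eq_weight_one]
    exact hP (mem_support_iff.1 α.2)
  · rw [map_sum, ← ha l]
    refine Finset.sum_congr rfl fun α _ => ?_
    simp only [eval_monomial, mul_comm, ← prod_X_pow_eq_monomial, Finsupp.prod]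

/-- Let `R` be a commutative `ℂ`-algebra with a `ℂ`-algebra map
`φ : ℂ[y₁,…,yₙ] → R`, `gᵢ = φ(yᵢ)`, and assume `R` is flat over `ℂ[y₁,…,yₙ]` via `φ`.
If `P ∈ R[T₁,…,Tₙ]` is homogeneous of degree `m ≥ 1` in the `Tᵢ` and `P(g₁,…,gₙ) = 0`,
then `P = Σ_{i,j} (gᵢ Tⱼ − gⱼ Tᵢ) P_{i,j}` with each `P_{i,j}` homogeneous of degree `m − 1`. -/
theorem stmt0 (n : ℕ) (hn : 1 ≤ n) (R : Type*) [CommRing R] [Algebra ℂ R]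
    (φ : MvPolynomial (Fin n) ℂ →ₐ[ℂ] R)
    (hflat : @Module.Flat (MvPolynomial (Fin n) ℂ) R _ _ φ.toRingHom.toModule)
    (m : ℕ) (hm : 1 ≤ m)
    (P : MvPolynomial (Fin n) R)
    (hP : P.IsHomogeneous m)
    (hPg : MvPolynomial.eval (fun i => φ (X i)) P = 0) :
    ∃ P' : Fin n → Fin n → MvPolynomial (Fin n) R,
      (∀ i j, (P' i j).IsHomogeneous (m - 1)) ∧
      P = ∑ i : Fin n, ∑ j : Fin n,
            (C (φ (X i)) * X j - C (φ (X j)) * X i) * P' i j := by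
  let _ := φ.toRingHom.toAlgebra
  have : Module.Flat (MvPolynomial (Fin n) ℂ) R := hflat
  obtain ⟨d, rfl⟩ := Nat.exists_eq_add_of_le' hm
  exact exists_eq_sum_of_mem_koszulSpan (mem_koszulSpan_of_flat (k := ℂ) hP hPg)
end

section
/- Let R be a commutative ℂ-algebra together with a ℂ-algebra homomorphism φ : ℂ[y₁,…,yₙ] → R, set gᵢ = φ(yᵢ), and assume R is flat as a module over ℂ[y₁,…,yₙ]. Let I = (g₁,…,gₙ) be the ideal of R generated by g₁,…,gₙ, let m ≥ 0, let Λ be a finite set of multi-indices ν ∈ ℕⁿ with |ν| = ν₁ + … + νₙ = m, and let (a_ν)_{ν∈Λ} be elements of R. If Σ_{ν∈Λ} a_ν·g^ν ∈ I^{m+1}, where g^ν = ∏ᵢ gᵢ^{νᵢ}, then a_ν ∈ I for every ν ∈ Λ. -/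
open MvPolynomial

/-- If `S` is flat over `k[σ]` and an `S`-linear combination of distinct monomials of degree `m`
lies in the `(m+1)`-st power of the extension of the ideal of variables, then all its coefficients
lie in that extension. -/
theorem mem_map_idealOfVars_of_sum_mem_pow {σ k S ι : Type*} [CommRing k] [CommRing S]
    [Algebra (MvPolynomial σ k) S] [Module.Flat (MvPolynomial σ k) S] [Fintype ι]
    (ν : ι → σ →₀ ℕ) (hν : Function.Injective ν) (m : ℕ) (hdeg : ∀ i, (ν i).degree = m)
    (a : ι → S)
    (hsum : ∑ i, a i * algebraMap (MvPolynomial σ k) S (monomial (ν i) 1) ∈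
      ((idealOfVars σ k).map (algebraMap (MvPolynomial σ k) S)) ^ (m + 1)) (i : ι) :
    a i ∈ (idealOfVars σ k).map (algebraMap (MvPolynomial σ k) S) := by
  classical
  rw [← Ideal.map_pow, Ideal.map, Ideal.span, Submodule.mem_span_set'] at hsum
  obtain ⟨r, b, g, hbg⟩ := hsum
  choose q hq hqg using fun j => (g j).2
  have hrel : Module.IsTrivialRelation
      (Sum.elim (fun i => monomial (ν i) (1 : k)) q) (Sum.elim a (fun j => -b j)) := by
    apply Module.Flat.isTrivialRelation_of_sum_smul_eq_zero
    simp only [Fintype.sum_sum_type, Sum.elim_inl, Sum.elim_inr, Algebra.smul_def, hqg, mul_neg,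
      Finset.sum_neg_distrib]
    rw [add_neg_eq_zero]
    simpa only [smul_eq_mul, mul_comm] using hbg.symm
  obtain ⟨l, p, y, hy, hp⟩ := hrel
  have ha : a i = ∑ j, p (Sum.inl i) j • y j := hy (Sum.inl i)
  rw [ha]
  refine Ideal.sum_mem _ fun j _ => ?_
  rw [Algebra.smul_def]
  refine Ideal.mul_mem_right _ _ (Ideal.mem_map_of_mem _ ?_)
  rw [← pow_one (idealOfVars σ k), mem_pow_idealOfVars_iff']
  intro x hx
  obtain rfl : x = 0 := by simpa [Finsupp.degree_eq_zero_iff] using hx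
  have hc := congrArg (coeff (ν i)) (hp j)
  have hq' : ∀ t, coeff (ν i) (q t * p (Sum.inr t) j) = 0 := fun t =>
    (mem_pow_idealOfVars_iff' _ _).1 (Ideal.mul_mem_right _ _ (hq t)) _ (by simp [hdeg])
  have hm : ∀ t, coeff (ν i) (monomial (ν t) 1 * p (Sum.inl t) j) =
      if t = i then coeff 0 (p (Sum.inl i) j) else 0 := by
    intro t
    rw [coeff_monomial_mul']
    split_ifs with hle hti hti
    · simp [hti]
    · obtain ⟨c, hc⟩ := le_iff_exists_add.1 hle
      have hdc := congrArg Finsupp.degree hc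
      simp only [map_add, hdeg, left_eq_add, Finsupp.degree_eq_zero_iff] at hdc
      exact absurd (hν (by simpa [hdc] using hc.symm)) hti
    · exact absurd (hti ▸ le_rfl) hle
    · rfl
  simpa [Fintype.sum_sum_type, coeff_sum, hq', hm] using hc

/-- With `R` flat over `ℂ[y₁,…,yₙ]` via `φ` and `gᵢ = φ(yᵢ)`, let
`I = (g₁,…,gₙ)`.  If `Λ` is a finite set of multi-indices `ν` with `|ν| = m` and
`Σ_{ν∈Λ} a_ν g^ν ∈ I^{m+1}`, then `a_ν ∈ I` for every `ν ∈ Λ`. -/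
theorem stmt1 (n : ℕ) (hn : 1 ≤ n) (R : Type*) [CommRing R] [Algebra ℂ R]
    (φ : MvPolynomial (Fin n) ℂ →ₐ[ℂ] R)
    (hflat : @Module.Flat (MvPolynomial (Fin n) ℂ) R _ _ φ.toRingHom.toModule)
    (m : ℕ) (Λ : Finset (Fin n → ℕ))
    (hΛ : ∀ ν ∈ Λ, ∑ i, ν i = m)
    (a : (Fin n → ℕ) → R)
    (hsum : (∑ ν ∈ Λ, a ν * ∏ i, φ (X i) ^ ν i) ∈
      (Ideal.span (Set.range fun i => φ (X i))) ^ (m + 1)) :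
    ∀ ν ∈ Λ, a ν ∈ Ideal.span (Set.range fun i => φ (X i)) := by
  let _ : Algebra (MvPolynomial (Fin n) ℂ) R := φ.toRingHom.toAlgebra
  have _ : Module.Flat (MvPolynomial (Fin n) ℂ) R := hflat
  have hφ : ∀ p, algebraMap (MvPolynomial (Fin n) ℂ) R p = φ p := fun _ => rfl
  have hI : Ideal.span (Set.range fun i => φ (X i)) =
      (idealOfVars (Fin n) ℂ).map (algebraMap (MvPolynomial (Fin n) ℂ) R) := by
    rw [idealOfVars, Ideal.map_span, ← Set.range_comp]
    rfl
  rw [hI] at hsum ⊢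
  intro ν hν
  refine mem_map_idealOfVars_of_sum_mem_pow
    (fun μ : Λ => Finsupp.equivFunOnFinite.symm (μ : Fin n → ℕ))
    (Finsupp.equivFunOnFinite.symm.injective.comp Subtype.val_injective) m
    (fun μ => by simpa [Finsupp.degree_eq_sum] using hΛ μ μ.2) (fun μ => a μ) ?_ ⟨ν, hν⟩
  rw [← Finset.sum_coe_sort] at hsum
  simpa [hφ, monomial_eq, Finsupp.prod_fintype] using hsum
end

section
/- With the weighted-homogeneous isolated-singularity setup, the Hilbert series of the graded Milnor algebra Q satisfies the identity (Σ_{k≥0} dim_ℂ(Q_k)·t^k) · ∏_{i=1}^{n} (1 − t^{dᵢ}) = ∏_{i=1}^{n} (1 − t^{d−dᵢ}) as an equality of formal power series in ℤ⟦t⟧. -/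
open MvPolynomial

/-- The Jacobian ideal of `f`, generated by its partial derivatives. -/
noncomputable def jacobianIdeal (n : ℕ) (f : MvPolynomial (Fin n) ℂ) :
    Ideal (MvPolynomial (Fin n) ℂ) :=
  Ideal.span (Set.range fun i => pderiv i f)

/-- The degree-`k` graded piece of the Milnor algebra `Q = ℂ[x]/J(f)` with respect to the
weighted grading `w`: the image in `Q` of the weighted homogeneous polynomials of degree `k`. -/
noncomputable def milnorPiece (n : ℕ) (w : Fin n → ℕ) (f : MvPolynomial (Fin n) ℂ) (k : ℕ) :
    Submodule ℂ (MvPolynomial (Fin n) ℂ ⧸ jacobianIdeal n f) :=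
  (weightedHomogeneousSubmodule ℂ w k).map
    (Ideal.Quotient.mkₐ ℂ (jacobianIdeal n f)).toLinearMap

section Depth

open RingTheory.Sequence CategoryTheory Abelian Limits Pointwise

universe u

variable {R : Type u} [CommRing R]

/-- The ideal `I` contains an `M`-regular sequence of length `r`. -/
def HasRegularSequence (I : Ideal R) (r : ℕ) (M : Type u) [AddCommGroup M] [Module R M] : Prop :=
  ∃ rs : List R, rs.length = r ∧ (∀ x ∈ rs, x ∈ I) ∧ IsRegular M rs

variable {M : Type u} [AddCommGroup M] [Module R M]

theorem HasRegularSequence.quotSMulTop [IsNoetherianRing R] [Module.Finite R M] {I : Ideal R}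
    {r : ℕ} {c : R} (hI : I • (⊤ : Submodule R M) < ⊤)
    (hIc : I • (⊤ : Submodule R (QuotSMulTop c M)) < ⊤)
    (h : HasRegularSequence I (r + 1) M) (hc : IsSMulRegular M c) :
    HasRegularSequence I r (QuotSMulTop c M) := by
  have hM : ∀ i < r + 1, Subsingleton
      (Ext (ModuleCat.of R (Shrink.{u} (R ⧸ I))) (ModuleCat.of R M) i) :=
    ((ModuleCat.exists_isRegular_tfae I (r + 1) (ModuleCat.of R M) hI).out 1 3).mpr h
  refine ((ModuleCat.exists_isRegular_tfae I r
    (ModuleCat.of R (QuotSMulTop c M)) hIc).out 1 3).mp fun i hi => ?_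
  have zero1 := AddCommGrpCat.isZero_of_iff_subsingleton.mpr (hM i (by omega))
  have zero2 := AddCommGrpCat.isZero_of_iff_subsingleton.mpr (hM (i + 1) (by omega))
  exact AddCommGrpCat.subsingleton_of_isZero <| ShortComplex.Exact.isZero_of_both_zeros
    (Ext.covariant_sequence_exact₃' _
      (IsSMulRegular.smulShortComplex_shortExact (M := ModuleCat.of R M) hc) i (i + 1) rfl)
    (zero1.eq_zero_of_src _) (zero2.eq_zero_of_tgt _)

theorem HasRegularSequence.of_quotSMulTop {I : Ideal R} {r : ℕ} {c : R} (hcI : c ∈ I)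
    (hc : IsSMulRegular M c) (h : HasRegularSequence I r (QuotSMulTop c M)) :
    HasRegularSequence I (r + 1) M := by
  obtain ⟨rs, hlen, hmem, hreg⟩ := h
  exact ⟨c :: rs, by simp [hlen], by simpa [hcI] using hmem, hreg.cons hc⟩

theorem IsSMulRegular.exists_smul_eq_of_quotSMulTop {c r : R}
    (h : IsSMulRegular (QuotSMulTop c M) r) {x y : M} (hxy : r • x = c • y) : ∃ z, x = c • z := by
  have : x ∈ c • (⊤ : Submodule R M) :=
    mem_of_isSMulRegular_quotient_of_smul_mem h
      (hxy ▸ Submodule.smul_mem_pointwise_smul y c ⊤ trivial)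
  obtain ⟨z, -, hz⟩ := this
  exact ⟨z, hz.symm⟩

variable [IsLocalRing R]

theorem smul_top_lt_top_of_le_maximalIdeal [Module.Finite R M] [Nontrivial M] {I : Ideal R}
    (hI : I ≤ IsLocalRing.maximalIdeal R) : I • (⊤ : Submodule R M) < ⊤ :=
  (Submodule.top_ne_ideal_smul_of_le_jacobson_annihilator
    (hI.trans (IsLocalRing.maximalIdeal_le_jacobson _))).symm.lt_top

variable [IsNoetherianRing R]

open IsLocalRing in
theorem exists_isSMulRegular_mem_of_sup_span_singleton [Module.Finite R M] {J : Ideal R} {a : R}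
    (ha : a ∈ maximalIdeal R)
    (h : ∃ c ∈ J ⊔ Ideal.span {a}, ∃ c' ∈ J ⊔ Ideal.span {a},
      IsSMulRegular M c ∧ IsSMulRegular (QuotSMulTop c M) c') :
    ∃ b ∈ J, IsSMulRegular M b := by
  obtain ⟨c, hc, c', hc', hreg, hreg'⟩ := h
  by_contra hJ
  let N : Submodule R M := Submodule.torsionBySet R M J
  have hN : N ≠ ⊥ := by
    intro hbot
    apply hJ
    have : Subsingleton ((R ⧸ J) →ₗ[R] M) := by
      refine subsingleton_of_forall_eq 0 fun φ => ?_
      have h1 : φ 1 ∈ N := by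
        rw [Submodule.mem_torsionBySet_iff]
        rintro ⟨j, hj⟩
        change j • φ 1 = 0
        rw [← map_smul, Algebra.smul_def, mul_one, Ideal.Quotient.algebraMap_eq,
          Ideal.Quotient.eq_zero_iff_mem.mpr hj, map_zero]
      rw [hbot, Submodule.mem_bot] at h1
      ext
      simpa using h1
    obtain ⟨r, hr, hr'⟩ := IsSMulRegular.subsingleton_linearMap_iff.mp this
    exact ⟨r, by rwa [Ideal.annihilator_quotient] at hr, hr'⟩
  obtain ⟨n, hn, hna⟩ : ∃ n ∈ N, ∀ z ∈ N, n ≠ a • z := by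
    by_contra! hcon
    refine hN (Submodule.eq_bot_of_le_smul_of_le_jacobson_bot (Ideal.span {a}) N
      (IsNoetherian.noetherian N) (fun n hn => ?_) ?_)
    · obtain ⟨z, hz, rfl⟩ := hcon n hn
      exact Submodule.smul_mem_smul (Ideal.mem_span_singleton_self a) hz
    · rw [Ideal.span_singleton_le_iff_mem]
      exact maximalIdeal_le_jacobson _ ha
  have hmem : ∀ {z}, z ∈ N ↔ ∀ j ∈ J, j • z = 0 := by
    intro z
    rw [Submodule.mem_torsionBySet_iff]
    exact Subtype.forall
  simp only [Submodule.mem_sup, Ideal.mem_span_singleton'] at hc hc'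
  obtain ⟨j, hj, _, ⟨u, rfl⟩, rfl⟩ := hc
  obtain ⟨j', hj', _, ⟨u', rfl⟩, rfl⟩ := hc'
  have hcN : ∀ z ∈ N, (j + u * a) • z = (u * a) • z := fun z hz => by
    rw [add_smul, hmem.mp hz j hj, zero_add]
  obtain ⟨z, hz⟩ := hreg'.exists_smul_eq_of_quotSMulTop (x := u • n) (y := u' • n) (by
    rw [add_smul, hmem.mp (N.smul_mem u hn) j' hj', zero_add, hcN _ (N.smul_mem u' hn)]
    simp only [smul_smul]
    congr 1
    ring)
  have hzN : z ∈ N := hmem.mpr fun i hi => hreg <| by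
    change (j + u * a) • i • z = (j + u * a) • (0 : M)
    rw [smul_comm, ← hz, smul_comm, hmem.mp hn i hi, smul_zero, smul_zero]
  refine hna z hzN (hreg ?_)
  change (j + u * a) • n = (j + u * a) • a • z
  rw [hcN n hn, smul_comm (j + u * a), ← hz, mul_comm, mul_smul]

open IsLocalRing in
/-- Removing one generator from an ideal of a Noetherian local ring lowers its grade by at most
one. -/
theorem HasRegularSequence.of_sup_span_singleton [Module.Finite R M] [Nontrivial M] {J : Ideal R}
    {a : R} {r : ℕ} (hJ : J ≤ maximalIdeal R) (ha : a ∈ maximalIdeal R)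
    (h : HasRegularSequence (J ⊔ Ideal.span {a}) (r + 1) M) : HasRegularSequence J r M := by
  induction r generalizing M with
  | zero => exact ⟨[], rfl, by simp, .nil R M⟩
  | succ r ih =>
    have hI : J ⊔ Ideal.span {a} ≤ maximalIdeal R :=
      sup_le hJ ((Ideal.span_singleton_le_iff_mem _).mpr ha)
    obtain ⟨b, hbJ, hb⟩ : ∃ b ∈ J, IsSMulRegular M b := by
      obtain ⟨rs, hlen, hmem, hreg⟩ := h
      match rs with
      | [] => simp at hlen
      | [_] => simp at hlen
      | c :: c' :: rs =>
        simp only [isRegular_cons_iff] at hreg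
        exact exists_isSMulRegular_mem_of_sup_span_singleton ha
          ⟨c, hmem c (by simp), c', hmem c' (by simp), hreg.1, hreg.2.1⟩
    have := nontrivial_quotSMulTop_of_mem_maximalIdeal (L := M) (hJ hbJ)
    exact .of_quotSMulTop hbJ hb <| ih <| h.quotSMulTop (smul_top_lt_top_of_le_maximalIdeal hI)
      (smul_top_lt_top_of_le_maximalIdeal hI) hb

open IsLocalRing in
theorem HasRegularSequence.of_sup_ofList [Module.Finite R M] [Nontrivial M] {J : Ideal R}
    {as : List R} {r : ℕ} (hJ : J ≤ maximalIdeal R) (has : ∀ a ∈ as, a ∈ maximalIdeal R)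
    (h : HasRegularSequence (J ⊔ Ideal.ofList as) (r + as.length) M) :
    HasRegularSequence J r M := by
  induction as generalizing J r with
  | nil => simpa using h
  | cons a as ih =>
    simp only [List.mem_cons, forall_eq_or_imp] at has
    refine .of_sup_span_singleton hJ has.1 (ih (sup_le hJ
      ((Ideal.span_singleton_le_iff_mem _).mpr has.1)) has.2 ?_)
    rw [Ideal.ofList_cons, ← sup_assoc] at h
    convert h using 1
    simp only [List.length_cons]
    ring

open IsLocalRing in
/-- If an ideal of a Noetherian local ring generated modulo the annihilator of `M` by `n` elements
contains an `M`-regular sequence of length `n`, then its generators form such a sequence. -/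
theorem HasRegularSequence.isWeaklyRegular [Module.Finite R M] [Nontrivial M] {J : Ideal R}
    {as : List R} (hJ : J ≤ maximalIdeal R) (hJM : J ≤ Module.annihilator R M)
    (has : ∀ a ∈ as, a ∈ maximalIdeal R)
    (h : HasRegularSequence (J ⊔ Ideal.ofList as) as.length M) : IsWeaklyRegular M as := by
  induction as generalizing M J with
  | nil => exact .nil R M
  | cons a as ih =>
    simp only [List.mem_cons, forall_eq_or_imp] at has
    have hJa : J ⊔ Ideal.span {a} ≤ maximalIdeal R :=
      sup_le hJ ((Ideal.span_singleton_le_iff_mem _).mpr has.1)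
    rw [Ideal.ofList_cons, ← sup_assoc, List.length_cons] at h
    have hreg : IsSMulRegular M a := by
      obtain ⟨rs, hlen, hmem, hreg⟩ := HasRegularSequence.of_sup_ofList (r := 1) hJa has.2
        (by rwa [add_comm])
      obtain ⟨c, rfl⟩ := List.length_eq_one_iff.mp hlen
      have hc := hmem c (by simp)
      simp only [Submodule.mem_sup, Ideal.mem_span_singleton'] at hc
      obtain ⟨j, hj, _, ⟨u, rfl⟩, rfl⟩ := hc
      have hr := ((isRegular_cons_iff M _ _).mp hreg).1
      intro x y hxy
      refine hr ?_
      change (j + u * a) • x = (j + u * a) • y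
      have hxy' : a • x = a • y := hxy
      rw [add_smul, add_smul, Module.mem_annihilator.mp (hJM hj),
        Module.mem_annihilator.mp (hJM hj), mul_smul, mul_smul, hxy']
    have := nontrivial_quotSMulTop_of_mem_maximalIdeal (L := M) has.1
    have hI : J ⊔ Ideal.span {a} ⊔ Ideal.ofList as ≤ maximalIdeal R :=
      sup_le hJa (Ideal.span_le.mpr has.2)
    refine .cons hreg (ih hJa (sup_le ?_ ?_) has.2 <|
      h.quotSMulTop (smul_top_lt_top_of_le_maximalIdeal hI)
        (smul_top_lt_top_of_le_maximalIdeal hI) hreg)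
    · exact hJM.trans (LinearMap.annihilator_le_of_surjective _ (Submodule.mkQ_surjective _))
    · rw [Ideal.span_singleton_le_iff_mem, Module.mem_annihilator]
      intro x
      induction x using Submodule.Quotient.induction_on with | _ x =>
      rw [← Submodule.Quotient.mk_smul, Submodule.Quotient.mk_eq_zero]
      exact Submodule.smul_mem_pointwise_smul x a ⊤ trivial

open IsLocalRing in
/-- In a Noetherian local ring with a regular sequence of length `n` generating an ideal contained
in the radical of `(a₁, …, aₙ)`, the elements `a₁, …, aₙ` form a regular sequence. -/
theorem RingTheory.Sequence.IsRegular.isWeaklyRegular_of_le_radical {rs as : List R}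
    (h : IsRegular R rs) (hlen : as.length = rs.length) (has : ∀ a ∈ as, a ∈ maximalIdeal R)
    (hrad : Ideal.ofList rs ≤ (Ideal.ofList as).radical) : IsWeaklyRegular R as := by
  have hle : Ideal.ofList as ≤ maximalIdeal R := Ideal.span_le.mpr has
  have hle' : Ideal.ofList rs ≤ maximalIdeal R :=
    hrad.trans ((maximalIdeal.isMaximal R).isPrime.isRadical.radical_le_iff.mpr hle)
  have hnt : Nontrivial (R ⧸ Ideal.ofList as) :=
    Ideal.Quotient.nontrivial_iff.mpr fun htop =>
      (maximalIdeal.isMaximal R).ne_top (top_le_iff.mp (htop ▸ hle))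
  have hsupp : Module.support R (R ⧸ Ideal.ofList as) =
      PrimeSpectrum.zeroLocus (Ideal.ofList as) := by
    rw [Module.support_eq_zeroLocus, Ideal.annihilator_quotient]
  refine HasRegularSequence.isWeaklyRegular (M := R) (J := ⊥) bot_le bot_le has ?_
  rw [bot_sup_eq, hlen]
  have hrees := (ModuleCat.exists_isRegular_tfae (Ideal.ofList as) rs.length (ModuleCat.of R R)
    (smul_top_lt_top_of_le_maximalIdeal hle)).out 2 3
  refine hrees.mp ⟨ModuleCat.of R (R ⧸ Ideal.ofList as), hnt, inferInstance, hsupp, ?_⟩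
  refine ModuleCat.subsingleton_ext_of_exists_isRegular (Ideal.ofList rs)
    (ModuleCat.of R (R ⧸ Ideal.ofList as)) ?_ (ModuleCat.of R R)
    (smul_top_lt_top_of_le_maximalIdeal hle') rs (fun r hr => Ideal.subset_span hr) h
  rw [hsupp]
  exact (PrimeSpectrum.zeroLocus_subset_zeroLocus_iff _ _).mpr hrad

end Depth

section GradedHilbert

open DirectSum

variable {K A : Type*} [Field K] [CommRing A] [Algebra K A] (𝒜 : ℕ → Submodule K A)

/-- The degree-`k` piece of `A ⧸ I`: the image of `𝒜 k`. -/
def gradedQuotientPiece (I : Ideal A) (k : ℕ) : Submodule K (A ⧸ I) :=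
  (𝒜 k).map (Ideal.Quotient.mkₐ K I).toLinearMap

/-- The Hilbert series of `A ⧸ I`. -/
noncomputable def quotientHilbertSeries (I : Ideal A) : PowerSeries ℤ :=
  PowerSeries.mk fun k => (Module.finrank K (gradedQuotientPiece 𝒜 I k) : ℤ)

variable {𝒜}

theorem mem_gradedQuotientPiece {I : Ideal A} {k : ℕ} {x : A ⧸ I} :
    x ∈ gradedQuotientPiece 𝒜 I k ↔ ∃ a ∈ 𝒜 k, Ideal.Quotient.mk I a = x := Iff.rfl

theorem finrank_map_add_finrank_ker_inf {V W : Type*} [AddCommGroup V] [Module K V]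
    [AddCommGroup W] [Module K W] (φ : V →ₗ[K] W) (p : Submodule K V) [FiniteDimensional K p] :
    Module.finrank K (p.map φ) + Module.finrank K (LinearMap.ker φ ⊓ p : Submodule K V) =
      Module.finrank K p := by
  have h := (φ.domRestrict p).finrank_range_add_finrank_ker
  rwa [LinearMap.range_domRestrict, LinearMap.ker_domRestrict,
    (Submodule.equivSubtypeMap p (Submodule.comap p.subtype (LinearMap.ker φ))).finrank_eq,
    Submodule.map_comap_subtype, inf_comm] at h

variable [GradedAlgebra 𝒜]

theorem exists_mem_eq_mul_of_mem_sup_span_singleton {I : Ideal A} (hI : I.IsHomogeneous 𝒜)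
    {g a : A} {e k : ℕ} (hg : g ∈ 𝒜 e) (ha : a ∈ 𝒜 k) (h : a ∈ I ⊔ Ideal.span {g}) :
    a ∈ I ∨ e ≤ k ∧ ∃ b ∈ 𝒜 (k - e), a - g * b ∈ I := by
  simp only [Submodule.mem_sup, Ideal.mem_span_singleton'] at h
  obtain ⟨i, hi, _, ⟨b, rfl⟩, rfl⟩ := h
  have hk := DirectSum.decompose_of_mem_same 𝒜 ha
  rw [decompose_add, DirectSum.add_apply, Submodule.coe_add, mul_comm,
    coe_decompose_mul_of_left_mem 𝒜 k hg] at hk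
  split_ifs at hk with hek
  · refine .inr ⟨hek, _, (decompose 𝒜 b (k - e)).2, ?_⟩
    rw [mul_comm b, ← hk, add_sub_cancel_right]
    exact hI k hi
  · refine .inl ?_
    rw [mul_comm b, ← hk, add_zero]
    exact hI k hi

/-- `g` is a nonzerodivisor on `A ⧸ I` as far as homogeneous elements are concerned. -/
def HomogeneousCancel (𝒜 : ℕ → Submodule K A) (I : Ideal A) (g : A) : Prop :=
  ∀ m, ∀ a ∈ 𝒜 m, g * a ∈ I → a ∈ I

variable [∀ k, FiniteDimensional K (𝒜 k)]

instance (I : Ideal A) (k : ℕ) : FiniteDimensional K (gradedQuotientPiece 𝒜 I k) := by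
  unfold gradedQuotientPiece; infer_instance

theorem finrank_gradedQuotientPiece_sup {I : Ideal A} (hI : I.IsHomogeneous 𝒜)
    {g : A} {e : ℕ} (hg : g ∈ 𝒜 e) (hreg : HomogeneousCancel 𝒜 I g) (k : ℕ) :
    Module.finrank K (gradedQuotientPiece 𝒜 (I ⊔ Ideal.span {g}) k) +
      (if e ≤ k then Module.finrank K (gradedQuotientPiece 𝒜 I (k - e)) else 0) =
      Module.finrank K (gradedQuotientPiece 𝒜 I k) := by
  let φ : (A ⧸ I) →ₗ[K] (A ⧸ I ⊔ Ideal.span {g}) :=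
    (Ideal.Quotient.factorₐ K (le_sup_left : I ≤ I ⊔ Ideal.span {g})).toLinearMap
  have hφ : (gradedQuotientPiece 𝒜 I k).map φ = gradedQuotientPiece 𝒜 (I ⊔ Ideal.span {g}) k := by
    rw [gradedQuotientPiece, ← Submodule.map_comp]
    rfl
  rw [← finrank_map_add_finrank_ker_inf φ (gradedQuotientPiece 𝒜 I k), hφ, Nat.add_left_cancel_iff]
  have hker : ∀ x, x ∈ LinearMap.ker φ ⊓ gradedQuotientPiece 𝒜 I k ↔
      ∃ a ∈ 𝒜 k, a ∈ I ⊔ Ideal.span {g} ∧ Ideal.Quotient.mk I a = x := by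
    intro x
    rw [Submodule.mem_inf, mem_gradedQuotientPiece]
    constructor
    · rintro ⟨hx, a, ha, rfl⟩
      exact ⟨a, ha, Ideal.Quotient.eq_zero_iff_mem.mp hx, rfl⟩
    · rintro ⟨a, ha, haI, rfl⟩
      exact ⟨Ideal.Quotient.eq_zero_iff_mem.mpr haI, a, ha, rfl⟩
  split_ifs with hek
  · let ψ : (A ⧸ I) →ₗ[K] (A ⧸ I) := LinearMap.mulLeft K (Ideal.Quotient.mk I g)
    have hψ : LinearMap.ker ψ ⊓ gradedQuotientPiece 𝒜 I (k - e) = ⊥ := by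
      rw [eq_bot_iff]
      rintro _ ⟨hx, a, ha, rfl⟩
      exact Ideal.Quotient.eq_zero_iff_mem.mpr
        (hreg _ a ha (Ideal.Quotient.eq_zero_iff_mem.mp hx))
    rw [← finrank_map_add_finrank_ker_inf ψ (gradedQuotientPiece 𝒜 I (k - e)), hψ, finrank_bot,
      add_zero]
    suffices h : (gradedQuotientPiece 𝒜 I (k - e)).map ψ =
        LinearMap.ker φ ⊓ gradedQuotientPiece 𝒜 I k by rw [h]
    ext x
    rw [hker]
    constructor
    · rintro ⟨_, ⟨b, hb, rfl⟩, rfl⟩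
      refine ⟨g * b, ?_, Ideal.mem_sup_right
        (Ideal.mul_mem_right _ _ (Ideal.mem_span_singleton_self g)), rfl⟩
      simpa [hek] using SetLike.mul_mem_graded hg hb
    · rintro ⟨a, ha, haI, rfl⟩
      obtain hI' | ⟨-, b, hb, hab⟩ := exists_mem_eq_mul_of_mem_sup_span_singleton hI hg ha haI
      · rw [Ideal.Quotient.eq_zero_iff_mem.mpr hI']
        exact zero_mem _
      · exact ⟨_, ⟨b, hb, rfl⟩, (Ideal.Quotient.eq.mpr hab).symm⟩
  · symm
    rw [Submodule.finrank_eq_zero, eq_bot_iff]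
    intro x hx
    obtain ⟨a, ha, haI, rfl⟩ := (hker x).mp hx
    obtain hI' | ⟨h, -⟩ := exists_mem_eq_mul_of_mem_sup_span_singleton hI hg ha haI
    · exact Ideal.Quotient.eq_zero_iff_mem.mpr hI'
    · exact absurd h hek

theorem quotientHilbertSeries_sup {I : Ideal A} (hI : I.IsHomogeneous 𝒜)
    {g : A} {e : ℕ} (hg : g ∈ 𝒜 e) (hreg : HomogeneousCancel 𝒜 I g) :
    quotientHilbertSeries 𝒜 (I ⊔ Ideal.span {g}) =
      quotientHilbertSeries 𝒜 I * (1 - PowerSeries.X ^ e) := by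
  ext k
  rw [mul_sub, mul_one, map_sub, PowerSeries.coeff_mul_X_pow', quotientHilbertSeries,
    quotientHilbertSeries, PowerSeries.coeff_mk, PowerSeries.coeff_mk, PowerSeries.coeff_mk,
    ← finrank_gradedQuotientPiece_sup hI hg hreg k]
  split_ifs <;> simp

/-- The Hilbert series of the quotient by a sequence of homogeneous elements that is regular as far
as homogeneous elements are concerned. -/
theorem quotientHilbertSeries_ofList (L : List (A × ℕ)) (hL : ∀ p ∈ L, p.1 ∈ 𝒜 p.2)
    (hreg : ∀ L₁ p L₂, L = L₁ ++ p :: L₂ →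
      HomogeneousCancel 𝒜 (Ideal.ofList (L₁.map Prod.fst)) p.1) :
    quotientHilbertSeries 𝒜 (Ideal.ofList (L.map Prod.fst)) =
      quotientHilbertSeries 𝒜 ⊥ * (L.map fun p => 1 - PowerSeries.X ^ p.2).prod := by
  induction L using List.reverseRecOn with
  | nil => simp
  | append_singleton L p ih =>
    have hhom : (Ideal.ofList (L.map Prod.fst)).IsHomogeneous 𝒜 := by
      refine Ideal.homogeneous_span 𝒜 _ fun x hx => ?_
      obtain ⟨q, hq, rfl⟩ := List.mem_map.mp hx
      exact ⟨q.2, hL q (List.mem_append_left _ hq)⟩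
    rw [List.map_append, List.map_append, Ideal.ofList_append, List.map_singleton,
      Ideal.ofList_singleton, quotientHilbertSeries_sup hhom (hL p (by simp)) (hreg L p [] rfl),
      ih (fun q hq => hL q (List.mem_append_left _ hq)), List.prod_append, mul_assoc]
    · simp
    · rintro L₁ q L₂ rfl
      exact hreg L₁ q (L₂ ++ [p]) (by simp)

end GradedHilbert

section WeightedHomogeneous

open RingTheory.Sequence

theorem RingTheory.Sequence.isWeaklyRegular_iff_forall_append {R : Type*} [CommRing R]
    (rs : List R) : IsWeaklyRegular R rs ↔ ∀ L₁ a L₂, rs = L₁ ++ a :: L₂ →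
      ∀ x, a * x ∈ Ideal.ofList L₁ → x ∈ Ideal.ofList L₁ := by
  have key : ∀ (L : List R) (a : R), IsSMulRegular (R ⧸ (Ideal.ofList L • ⊤ : Ideal R)) a ↔
      ∀ x, a * x ∈ Ideal.ofList L → x ∈ Ideal.ofList L := fun L a => by
    rw [isSMulRegular_quotient_iff_mem_of_smul_mem, smul_eq_mul, Ideal.mul_top]
    rfl
  constructor
  · rintro h L₁ a L₂ rfl
    exact (key _ _).mp
      ((isWeaklyRegular_cons_iff _ _ _).mp ((isWeaklyRegular_append_iff _ _ _).mp h).2).1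
  · exact fun h => ⟨fun i hi => (key _ _).mpr (h _ _ (rs.drop (i + 1)) (by simp))⟩

theorem ofList_map_finRange {R : Type*} [CommRing R] {n : ℕ} (F : Fin n → R) :
    Ideal.ofList ((List.finRange n).map F) = Ideal.span (Set.range F) := by
  change Ideal.span {r | r ∈ (List.finRange n).map F} = _
  congr 1
  ext x
  simp

variable {K : Type*} [Field K] {n : ℕ} {w : Fin n → ℕ}

attribute [local instance] MvPolynomial.weightedGradedAlgebra

theorem decompose_weightedHomogeneousSubmodule_apply (p : MvPolynomial (Fin n) K) (k : ℕ) :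
    (DirectSum.decompose (weightedHomogeneousSubmodule K w) p k : MvPolynomial (Fin n) K) =
      weightedHomogeneousComponent w k p :=
  weightedDecomposition.decompose'_apply K w p k

theorem MvPolynomial.mem_span_X_image_of_X_mul_mem {σ R : Type*} [CommSemiring R] {s : Set σ}
    {i : σ} (hi : i ∉ s) {p : MvPolynomial σ R}
    (h : X i * p ∈ Ideal.span (X '' s : Set (MvPolynomial σ R))) :
    p ∈ Ideal.span (X '' s : Set (MvPolynomial σ R)) := by
  classical
  rw [mem_ideal_span_X_image] at h ⊢
  intro m hm
  obtain ⟨j, hj, hne⟩ := h (Finsupp.single i 1 + m) (by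
    rw [mem_support_iff, coeff_X_mul]
    exact mem_support_iff.mp hm)
  refine ⟨j, hj, ?_⟩
  have hij : i ≠ j := fun hij => hi (hij ▸ hj)
  simpa [Finsupp.single_eq_of_ne' hij] using hne

theorem MvPolynomial.isWeaklyRegular_map_X {σ R : Type*} [CommRing R] {L : List σ}
    (hL : L.Nodup) : IsWeaklyRegular (MvPolynomial σ R) (L.map (X : σ → MvPolynomial σ R)) := by
  rw [isWeaklyRegular_iff_forall_append]
  intro L₁ a L₂ h
  obtain ⟨L₁, _, rfl, rfl, hL₂⟩ := List.map_eq_append_iff.mp h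
  obtain ⟨i, L₂, rfl, rfl, -⟩ := List.map_eq_cons_iff.mp hL₂
  have hspan : Ideal.ofList (L₁.map (X : σ → MvPolynomial σ R)) =
      Ideal.span (X '' {j | j ∈ L₁}) := by
    change Ideal.span {r | r ∈ L₁.map X} = _
    congr 1
    ext x
    simp
  rw [hspan]
  refine fun x hx => mem_span_X_image_of_X_mul_mem ?_ hx
  intro hi
  exact (List.nodup_append.mp hL).2.2 i hi i (by simp) rfl

theorem exists_X_pow_mem_of_finiteDimensional (hw : ∀ i, 0 < w i)
    {J : Ideal (MvPolynomial (Fin n) K)} (hJ : J.IsHomogeneous (weightedHomogeneousSubmodule K w))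
    [FiniteDimensional K (MvPolynomial (Fin n) K ⧸ J)] (i : Fin n) : ∃ N, X i ^ N ∈ J := by
  obtain ⟨p, hp, hp0⟩ := Algebra.IsIntegral.isIntegral (R := K) (Ideal.Quotient.mkₐ K J (X i))
  refine ⟨p.natDegree, ?_⟩
  rw [← Polynomial.aeval_def, Polynomial.aeval_algHom_apply] at hp0
  have hmem : Polynomial.aeval (X i : MvPolynomial (Fin n) K) p ∈ J :=
    Ideal.Quotient.eq_zero_iff_mem.mp hp0
  have hhom : ∀ k, IsWeightedHomogeneous w (p.coeff k • X i ^ k : MvPolynomial (Fin n) K)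
      (k • w i) := fun k =>
    (weightedHomogeneousSubmodule K w _).smul_mem _ ((isWeightedHomogeneous_X K w i).pow k)
  have hcomp := weightedHomogeneousComponent_mem_of_mem K w hJ hmem (p.natDegree • w i)
  rw [Polynomial.aeval_eq_sum_range, map_sum, Finset.sum_eq_single_of_mem p.natDegree (by simp),
    (hhom _).weightedHomogeneousComponent_same, hp.coeff_natDegree, one_smul] at hcomp
  · exact hcomp
  · intro k _ hk
    refine (hhom k).weightedHomogeneousComponent_ne _ fun h => hk ?_
    simpa [(hw i).ne'] using h.symm

theorem homogeneousCancel_of_exists_mul_mem (hw : ∀ i, 0 < w i)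
    {J : Ideal (MvPolynomial (Fin n) K)} (hJ : J.IsHomogeneous (weightedHomogeneousSubmodule K w))
    {m : ℕ} {g s : MvPolynomial (Fin n) K} (hg : IsWeightedHomogeneous w g m)
    (hs : constantCoeff s ≠ 0) (h : s * g ∈ J) : g ∈ J := by
  have hm := hJ m h
  rw [DirectSum.coe_decompose_mul_of_right_mem_of_le (weightedHomogeneousSubmodule K w) hg le_rfl,
    Nat.sub_self, decompose_weightedHomogeneousSubmodule_apply,
    weightedHomogeneousComponent_zero _ fun i => (hw i).ne'] at hm
  have := J.mul_mem_left (C (constantCoeff s)⁻¹) hm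
  rwa [← mul_assoc, ← C_mul, ← constantCoeff_eq, inv_mul_cancel₀ hs, C_1, one_mul] at this

/-- Homogeneous polynomials `F₁, …, Fₙ` of positive degrees in `n` variables whose quotient is
finite-dimensional form a regular sequence, as far as homogeneous elements are concerned. -/
theorem homogeneousCancel_of_finiteDimensional (hw : ∀ i, 0 < w i)
    {F : Fin n → MvPolynomial (Fin n) K} {e : Fin n → ℕ} (he : ∀ i, 0 < e i)
    (hF : ∀ i, IsWeightedHomogeneous w (F i) (e i))
    [FiniteDimensional K (MvPolynomial (Fin n) K ⧸ Ideal.span (Set.range F))]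
    {L₁ L₂ : List (MvPolynomial (Fin n) K)} {p : MvPolynomial (Fin n) K}
    (hL : (List.finRange n).map F = L₁ ++ p :: L₂) :
    HomogeneousCancel (weightedHomogeneousSubmodule K w) (Ideal.ofList L₁) p := by
  let 𝔪 : Ideal (MvPolynomial (Fin n) K) := RingHom.ker constantCoeff
  have : 𝔪.IsPrime := RingHom.ker_isPrime _
  let S := Localization.AtPrime 𝔪
  let ι := algebraMap (MvPolynomial (Fin n) K) S
  have hF𝔪 : ∀ i, F i ∈ 𝔪 := fun i => by
    rw [RingHom.mem_ker, constantCoeff_eq]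
    refine (hF i).coeff_eq_zero 0 ?_
    simpa using (he i).ne
  have hhom : ∀ L : List (MvPolynomial (Fin n) K), (∀ x ∈ L, ∃ i, F i = x) →
      (Ideal.ofList L).IsHomogeneous (weightedHomogeneousSubmodule K w) := fun L hL =>
    Ideal.homogeneous_span _ _ fun x hx => by
      obtain ⟨i, rfl⟩ := hL x hx
      exact ⟨e i, hF i⟩
  have hspan := ofList_map_finRange F
  have hX : IsRegular S (((List.finRange n).map X).map ι) :=
    (isWeaklyRegular_map_X (List.nodup_finRange n)).isRegular_of_isLocalization_of_mem S 𝔪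
      (by simp [𝔪, RingHom.mem_ker])
  have hreg : IsWeaklyRegular S (((List.finRange n).map F).map ι) := by
    refine hX.isWeaklyRegular_of_le_radical (by simp) ?_ ?_
    · simp only [List.forall_mem_map]
      exact fun i _ => (IsLocalization.AtPrime.to_map_mem_maximal_iff S 𝔪 _).mpr (hF𝔪 i)
    · refine Ideal.span_le.mpr fun x hx => ?_
      simp only [List.mem_map, List.mem_finRange, true_and, exists_exists_eq_and,
        Set.mem_ofPred_eq] at hx
      obtain ⟨i, rfl⟩ := hx
      obtain ⟨N, hN⟩ := exists_X_pow_mem_of_finiteDimensional hw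
        (hspan ▸ hhom ((List.finRange n).map F) (by simp)) i
      refine ⟨N, ?_⟩
      rw [← map_pow, ← Ideal.map_ofList, hspan]
      exact Ideal.mem_map_of_mem _ hN
  intro m g hg hpg
  have hg' : ι g ∈ (Ideal.ofList L₁).map ι := by
    rw [Ideal.map_ofList]
    refine (isWeaklyRegular_iff_forall_append _).mp hreg _ (ι p) (L₂.map ι) (by simp [hL]) _ ?_
    rw [← map_mul, ← Ideal.map_ofList]
    exact Ideal.mem_map_of_mem _ hpg
  obtain ⟨s, hs, hsg⟩ :=
    (IsLocalization.algebraMap_mem_map_algebraMap_iff 𝔪.primeCompl S _ _).mp hg'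
  refine homogeneousCancel_of_exists_mul_mem hw (hhom L₁ fun x hx => ?_) hg hs hsg
  have hx' : x ∈ (List.finRange n).map F := by
    rw [hL]
    exact List.mem_append_left _ hx
  simpa using hx'

/-- The Hilbert series of the quotient by `n` homogeneous polynomials of positive degrees `eᵢ` in
`n` variables, if this quotient is finite-dimensional. -/
theorem quotientHilbertSeries_span_range (hw : ∀ i, 0 < w i)
    {F : Fin n → MvPolynomial (Fin n) K} {e : Fin n → ℕ} (he : ∀ i, 0 < e i)
    (hF : ∀ i, IsWeightedHomogeneous w (F i) (e i))
    [FiniteDimensional K (MvPolynomial (Fin n) K ⧸ Ideal.span (Set.range F))] :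
    quotientHilbertSeries (weightedHomogeneousSubmodule K w) (Ideal.span (Set.range F)) =
      quotientHilbertSeries (weightedHomogeneousSubmodule K w) ⊥ *
        ∏ i, (1 - PowerSeries.X ^ e i) := by
  have (k : ℕ) : FiniteDimensional K (weightedHomogeneousSubmodule K w k) :=
    .of_fg (weightedHomogeneousSubmodule_fg (R := K) w (fun i => (hw i).ne') k)
  have h := quotientHilbertSeries_ofList (𝒜 := weightedHomogeneousSubmodule K w)
    ((List.finRange n).map fun i => (F i, e i)) (by simpa using hF) fun L₁ p L₂ hL =>
      homogeneousCancel_of_finiteDimensional hw he hF (L₂ := L₂.map Prod.fst) (by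
        simpa [Function.comp_def] using congrArg (List.map Prod.fst) hL)
  have hspan : Ideal.ofList (((List.finRange n).map fun i => (F i, e i)).map Prod.fst) =
      Ideal.span (Set.range F) := by
    rw [List.map_map, ← ofList_map_finRange]
    rfl
  rw [hspan, List.map_map] at h
  rw [h, ← List.prod_ofFn, List.ofFn_eq_map]
  rfl

theorem MvPolynomial.span_range_X_eq_ker_constantCoeff {σ R : Type*} [CommRing R] :
    Ideal.span (Set.range (X : σ → MvPolynomial σ R)) = RingHom.ker constantCoeff := by
  ext p
  rw [← Set.image_univ, mem_ideal_span_X_image, RingHom.mem_ker, constantCoeff_eq]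
  constructor
  · intro h
    by_contra h0
    obtain ⟨i, -, hi⟩ := h 0 (mem_support_iff.mpr h0)
    exact hi rfl
  · intro h m hm
    have hm0 : m ≠ 0 := by
      rintro rfl
      exact mem_support_iff.mp hm h
    obtain ⟨i, hi⟩ := Finsupp.ne_iff.mp hm0
    exact ⟨i, trivial, hi⟩

theorem MvPolynomial.mk_span_range_X_eq {σ R : Type*} [CommRing R] (p : MvPolynomial σ R) :
    Ideal.Quotient.mk (Ideal.span (Set.range X)) p =
      Ideal.Quotient.mk (Ideal.span (Set.range X)) (C (constantCoeff p)) := by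
  rw [Ideal.Quotient.eq, span_range_X_eq_ker_constantCoeff, RingHom.mem_ker]
  simp

theorem quotientHilbertSeries_span_range_X :
    quotientHilbertSeries (weightedHomogeneousSubmodule K w)
      (Ideal.span (Set.range (X : Fin n → MvPolynomial (Fin n) K))) = 1 := by
  have hnt : Nontrivial
      (MvPolynomial (Fin n) K ⧸ Ideal.span (Set.range (X : Fin n → MvPolynomial (Fin n) K))) := by
    rw [span_range_X_eq_ker_constantCoeff]
    exact Ideal.Quotient.nontrivial_iff.mpr (RingHom.ker_ne_top _)
  ext k
  rw [quotientHilbertSeries, PowerSeries.coeff_mk, PowerSeries.coeff_one]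
  split_ifs with hk
  · subst hk
    have hspan : gradedQuotientPiece (weightedHomogeneousSubmodule K w)
        (Ideal.span (Set.range (X : Fin n → MvPolynomial (Fin n) K))) 0 = K ∙ 1 := by
      ext x
      rw [mem_gradedQuotientPiece, Submodule.mem_span_singleton]
      constructor
      · rintro ⟨a, -, rfl⟩
        refine ⟨constantCoeff a, ?_⟩
        rw [mk_span_range_X_eq, Algebra.smul_def, mul_one]
        rfl
      · rintro ⟨r, rfl⟩
        refine ⟨C r, isWeightedHomogeneous_C w r, ?_⟩
        rw [Algebra.smul_def, mul_one]
        rfl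
    rw [hspan, finrank_span_singleton one_ne_zero, Nat.cast_one]
  · have hbot : gradedQuotientPiece (weightedHomogeneousSubmodule K w)
        (Ideal.span (Set.range (X : Fin n → MvPolynomial (Fin n) K))) k = ⊥ := by
      rw [eq_bot_iff]
      rintro _ ⟨a, ha, rfl⟩
      change Ideal.Quotient.mk _ a = 0
      rw [mk_span_range_X_eq, constantCoeff_eq,
        IsWeightedHomogeneous.coeff_eq_zero ha 0 (by simpa using Ne.symm hk), C_0, map_zero]
    rw [hbot, finrank_bot, Nat.cast_zero]

theorem quotientHilbertSeries_bot_mul_prod (hw : ∀ i, 0 < w i) :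
    quotientHilbertSeries (weightedHomogeneousSubmodule K w) ⊥ *
      ∏ i, (1 - PowerSeries.X ^ w i) = 1 := by
  have : FiniteDimensional K
      (MvPolynomial (Fin n) K ⧸ Ideal.span (Set.range (X : Fin n → MvPolynomial (Fin n) K))) := by
    refine Module.Finite.of_surjective (Algebra.linearMap K _) fun x => ?_
    obtain ⟨p, rfl⟩ := Ideal.Quotient.mk_surjective x
    exact ⟨constantCoeff p, (mk_span_range_X_eq p).symm⟩
  rw [← quotientHilbertSeries_span_range hw hw (isWeightedHomogeneous_X K w),
    quotientHilbertSeries_span_range_X]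

end WeightedHomogeneous

/-- For a weighted homogeneous polynomial `f` of degree `d` (weights `w i`,
`2 w i ≤ d`) with an isolated singularity at `0`, the Hilbert series of the graded Milnor
algebra satisfies `(Σ_k dim Q_k t^k) ∏ᵢ (1 − t^{wᵢ}) = ∏ᵢ (1 − t^{d−wᵢ})` in `ℤ⟦t⟧`. -/
theorem stmt2 (n : ℕ) (hn : 1 ≤ n) (d : ℕ) (w : Fin n → ℕ)
    (hd : 0 < d) (hw : ∀ i, 0 < w i) (hwd : ∀ i, 2 * w i ≤ d)
    (f : MvPolynomial (Fin n) ℂ)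
    (hf : MvPolynomial.IsWeightedHomogeneous w f d)
    (hiso : FiniteDimensional ℂ (MvPolynomial (Fin n) ℂ ⧸ jacobianIdeal n f)) :
    (PowerSeries.mk fun k => (Module.finrank ℂ (milnorPiece n w f k) : ℤ)) *
        ∏ i : Fin n, (1 - (PowerSeries.X : PowerSeries ℤ) ^ (w i)) =
      ∏ i : Fin n, (1 - (PowerSeries.X : PowerSeries ℤ) ^ (d - w i)) := by
  have he : ∀ i, 0 < d - w i := fun i => by have := hw i; have := hwd i; omega
  have : FiniteDimensional ℂ
      (MvPolynomial (Fin n) ℂ ⧸ Ideal.span (Set.range fun i => pderiv i f)) := hiso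
  have hQ := quotientHilbertSeries_span_range hw he
    (F := fun i => pderiv i f) fun i => hf.pderiv (by have := hwd i; omega)
  change quotientHilbertSeries (weightedHomogeneousSubmodule ℂ w)
    (Ideal.span (Set.range fun i => pderiv i f)) * _ = _
  rw [hQ, mul_right_comm, quotientHilbertSeries_bot_mul_prod hw, one_mul]
end

section
/- With the weighted-homogeneous isolated-singularity setup, the dimension of the Milnor algebra satisfies (∏_{i=1}^{n} dᵢ) · dim_ℂ Q = ∏_{i=1}^{n} (d − dᵢ). -/
open MvPolynomial

section LocalAlgebra

open scoped Pointwise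
open IsLocalRing RingTheory.Sequence CategoryTheory Abelian

universe u

variable {R : Type u} [CommRing R]

lemma ringKrullDim_quotient_add_one_le_of_lt {p q : Ideal R} [p.IsPrime] (h : p < q) :
    ringKrullDim (R ⧸ q) + 1 ≤ ringKrullDim (R ⧸ p) := by
  obtain ⟨hle, a, haq, hap⟩ := SetLike.lt_iff_le_and_exists.mp h
  have ha : Ideal.Quotient.mk p a ∈ nonZeroDivisors (R ⧸ p) := by
    rw [mem_nonZeroDivisors_iff_ne_zero]
    rwa [Ne, Ideal.Quotient.eq_zero_iff_mem]
  refine le_trans ?_ (ringKrullDim_quotient_succ_le_of_nonZeroDivisor ha)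
  gcongr
  let f : ((R ⧸ p) ⧸ Ideal.span {Ideal.Quotient.mk p a}) →+* R ⧸ q :=
    Ideal.Quotient.lift _ (Ideal.Quotient.factor hle) (by
      intro x hx
      obtain ⟨y, rfl⟩ := Ideal.mem_span_singleton'.mp hx
      simp [Ideal.Quotient.eq_zero_iff_mem.mpr haq])
  refine ringKrullDim_le_of_surjective f ?_
  exact Ideal.Quotient.lift_surjective_of_surjective _ _ (Ideal.Quotient.factor_surjective hle)

variable [IsLocalRing R] [IsNoetherianRing R]

lemma ringKrullDim_quotient_le_length_of_minimal {p : Ideal R} [p.IsPrime] (bs : List R)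
    (h : ∀ q : Ideal R, q.IsPrime → p ≤ q → (∀ b ∈ bs, b ∈ q) → q = maximalIdeal R)
    (hbs : ∀ b ∈ bs, b ∈ maximalIdeal R) :
    ringKrullDim (R ⧸ p) ≤ bs.length := by
  classical
  have hloc : IsLocalRing (R ⧸ p) :=
    IsLocalRing.of_surjective' (Ideal.Quotient.mk p) Ideal.Quotient.mk_surjective
  have hcomap : (maximalIdeal (R ⧸ p)).comap (Ideal.Quotient.mk p) = maximalIdeal R :=
    IsLocalRing.eq_maximalIdeal
      (Ideal.comap_isMaximal_of_surjective _ Ideal.Quotient.mk_surjective)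
  rw [← IsLocalRing.maximalIdeal_height_eq_ringKrullDim]
  let s : Finset (R ⧸ p) := (bs.map (Ideal.Quotient.mk p)).toFinset
  have hs : s.card ≤ bs.length := by
    simpa [s] using List.toFinset_card_le (bs.map (Ideal.Quotient.mk p))
  have hmin : maximalIdeal (R ⧸ p) ∈ (Ideal.span (s : Set (R ⧸ p))).minimalPrimes := by
    refine ⟨⟨inferInstance, ?_⟩, ?_⟩
    · rw [Ideal.span_le]
      intro x hx
      obtain ⟨b, hb, rfl⟩ : ∃ b ∈ bs, Ideal.Quotient.mk p b = x := by simpa [s] using hx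
      rw [SetLike.mem_coe, ← Ideal.mem_comap, hcomap]
      exact hbs b hb
    · rintro q ⟨hq, hsq⟩ -
      have : q.comap (Ideal.Quotient.mk p) = maximalIdeal R := by
        refine h _ (Ideal.comap_isPrime _ _) ?_ ?_
        · intro x hx
          simp [Ideal.mem_comap, Ideal.Quotient.eq_zero_iff_mem.mpr hx]
        · intro b hb
          refine hsq (Ideal.subset_span ?_)
          simp only [s, List.coe_toFinset, List.mem_map, Set.mem_ofPred_eq]
          exact ⟨b, hb, rfl⟩
      rw [← Ideal.map_comap_of_surjective _ Ideal.Quotient.mk_surjective (maximalIdeal (R ⧸ p)),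
        hcomap, ← this, Ideal.map_comap_of_surjective _ Ideal.Quotient.mk_surjective]
  have := Ideal.height_le_card_of_mem_minimalPrimes_span_finset hmin
  have h2 : (maximalIdeal (R ⧸ p)).height ≤ (bs.length : ℕ∞) :=
    this.trans (by exact_mod_cast hs)
  exact_mod_cast h2

/-- An associated prime of `M` is strictly contained in some associated prime of `M / aM`
whenever `a` is an `M`-regular element of the maximal ideal. -/
lemma exists_isAssociatedPrime_quotSMulTop {M : Type*} [AddCommGroup M] [Module R M]
    [Module.Finite R M] {a : R} (ha : IsSMulRegular M a) (ham : a ∈ maximalIdeal R)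
    {p : Ideal R} (hp : IsAssociatedPrime p M) :
    ∃ q : Ideal R, IsAssociatedPrime q (QuotSMulTop a M) ∧ p < q := by
  obtain ⟨hpp, x, hx⟩ := isAssociatedPrime_iff.mp hp
  let N : Submodule R M := Submodule.torsionBySet R M p
  have hN : ∀ m, m ∈ N ↔ ∀ r ∈ p, r • m = 0 := by
    intro m
    simp [N, Submodule.mem_torsionBySet_iff]
  have hx0 : x ≠ 0 := by
    rintro rfl
    exact hpp.ne_top (by rw [hx]; ext; simp [Submodule.mem_colon_singleton])
  have hxN : x ∈ N := by
    rw [hN]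
    intro r hr
    rw [hx] at hr
    simpa [Submodule.mem_colon_singleton] using hr
  have hap : a ∉ p := by
    intro h
    exact hx0 (ha (by simpa using (hN x).mp hxN a h))
  have hnot : ¬ N ≤ a • (⊤ : Submodule R M) := by
    intro hle
    have : N ≤ maximalIdeal R • N := by
      intro m hm
      obtain ⟨m', -, rfl⟩ := (Submodule.mem_smul_pointwise_iff_exists _ _ _).mp (hle hm)
      refine Submodule.smul_mem_smul ham ((hN m').mpr fun r hr => ?_)
      have := (hN _).mp hm r hr
      rw [smul_comm] at this
      exact ha (by simpa using this)
    have hbot := Submodule.eq_bot_of_le_smul_of_le_jacobson_bot _ N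
      (IsNoetherian.noetherian N) this (maximalIdeal_le_jacobson _)
    exact hx0 (by simpa [hbot] using hxN)
  obtain ⟨m, hm, hma⟩ := SetLike.not_le_iff_exists.mp hnot
  have hm0 : (Submodule.Quotient.mk m : QuotSMulTop a M) ≠ 0 := by
    rwa [Ne, Submodule.Quotient.mk_eq_zero]
  obtain ⟨q, hq, hle⟩ := exists_le_isAssociatedPrime_of_isNoetherianRing R _ hm0
  have hpq : p ≤ q := by
    intro r hr
    refine hle ?_
    rw [Submodule.mem_colon_singleton, ← Submodule.Quotient.mk_smul, (hN m).mp hm r hr]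
    simp
  refine ⟨q, hq, SetLike.lt_iff_le_and_exists.mpr ⟨hpq, a, hle ?_, hap⟩⟩
  rw [Submodule.mem_colon_singleton, ← Submodule.Quotient.mk_smul, Submodule.mem_bot,
    Submodule.Quotient.mk_eq_zero]
  exact Submodule.smul_mem_pointwise_smul _ _ _ trivial

lemma length_le_ringKrullDim_quotient_of_isAssociatedPrime (rs : List R)
    (hrs : ∀ r ∈ rs, r ∈ maximalIdeal R) {M : Type*} [AddCommGroup M] [Module R M]
    [Module.Finite R M] (hreg : IsRegular M rs) {p : Ideal R} (hp : IsAssociatedPrime p M) :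
    rs.length ≤ ringKrullDim (R ⧸ p) := by
  induction rs generalizing M p with
  | nil =>
    have : Nontrivial (R ⧸ p) := Ideal.Quotient.nontrivial_iff.mpr hp.isPrime.ne_top
    simpa using ringKrullDim_nonneg_of_nontrivial
  | cons a rs ih =>
    have := hp.isPrime
    rw [isRegular_cons_iff] at hreg
    obtain ⟨q, hq, hpq⟩ := exists_isAssociatedPrime_quotSMulTop hreg.1 (hrs a (by simp)) hp
    refine le_trans ?_ (ringKrullDim_quotient_add_one_le_of_lt hpq)
    simp only [List.length_cons, Nat.cast_add, Nat.cast_one]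
    gcongr
    exact ih (fun r hr => hrs r (by simp [hr])) hreg.2 hq

lemma exists_isRegular_quotSMulTop {M : Type u} [AddCommGroup M] [Module R M]
    [Module.Finite R M] {k : ℕ}
    (h : ∃ rs : List R, rs.length = k + 1 ∧ (∀ r ∈ rs, r ∈ maximalIdeal R) ∧ IsRegular M rs)
    {b : R} (hb : IsSMulRegular M b) (hbm : b ∈ maximalIdeal R) :
    ∃ rs : List R, rs.length = k ∧ (∀ r ∈ rs, r ∈ maximalIdeal R) ∧
      IsRegular (QuotSMulTop b M) rs := by
  have hnt : Nontrivial M := by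
    obtain ⟨rs, -, -, h⟩ := h
    exact h.nontrivial
  have hlt : ∀ (N : Type u) [AddCommGroup N] [Module R N] [Module.Finite R N] [Nontrivial N],
      maximalIdeal R • (⊤ : Submodule R N) < ⊤ := by
    intro N _ _ _ _
    exact lt_top_iff_ne_top.mpr (Submodule.top_ne_ideal_smul_of_le_jacobson_annihilator
      (maximalIdeal_le_jacobson _)).symm
  have hnt' : Nontrivial (QuotSMulTop b M) := nontrivial_quotSMulTop_of_mem_maximalIdeal M hbm
  have h1 := ((ModuleCat.exists_isRegular_tfae (maximalIdeal R) (k + 1)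
    (ModuleCat.of R M) (hlt M)).out 3 1).mp h
  refine ((ModuleCat.exists_isRegular_tfae (maximalIdeal R) k
    (ModuleCat.of R (QuotSMulTop b M)) (hlt _)).out 1 3).mp ?_
  intro i hi
  have zero1 := AddCommGrpCat.isZero_of_iff_subsingleton.mpr (h1 i (by omega))
  have zero2 := AddCommGrpCat.isZero_of_iff_subsingleton.mpr (h1 (i + 1) (by omega))
  exact AddCommGrpCat.subsingleton_of_isZero <| ShortComplex.Exact.isZero_of_both_zeros
    ((Ext.covariant_sequence_exact₃' _
      (IsSMulRegular.smulShortComplex_shortExact (M := ModuleCat.of R M) hb)) i (i + 1) rfl)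
    (zero1.eq_zero_of_src _) (zero2.eq_zero_of_tgt _)

/-- Over a Noetherian local ring, a system of parameters of a Cohen-Macaulay module is a regular
sequence. -/
theorem isWeaklyRegular_of_forall_eq_maximalIdeal (bs : List R)
    (hbs : ∀ b ∈ bs, b ∈ maximalIdeal R) {M : Type u} [AddCommGroup M] [Module R M]
    [Module.Finite R M]
    (hdepth : ∃ rs : List R, rs.length = bs.length ∧ (∀ r ∈ rs, r ∈ maximalIdeal R) ∧
      IsRegular M rs)
    (hsop : ∀ q : Ideal R, q.IsPrime → Module.annihilator R M ≤ q → (∀ b ∈ bs, b ∈ q) →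
      q = maximalIdeal R) :
    IsWeaklyRegular M bs := by
  induction bs generalizing M with
  | nil => simp
  | cons b bs ih =>
    have hb : IsSMulRegular M b := by
      by_contra hb
      have hmem : b ∈ ⋃ p ∈ associatedPrimes R M, (p : Set R) := by
        rw [biUnion_associatedPrimes_eq_compl_regular]
        exact hb
      obtain ⟨p, hp, hbp⟩ : ∃ p ∈ associatedPrimes R M, b ∈ p := by simpa using hmem
      have := IsAssociatedPrime.isPrime hp
      have hann : Module.annihilator R M ≤ p := by
        simpa only [Submodule.annihilator_top] using IsAssociatedPrime.annihilator_le hp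
      have hle := ringKrullDim_quotient_le_length_of_minimal (p := p) bs
        (fun q hq hpq hq' => hsop q hq (hann.trans hpq) (by simpa [hpq hbp] using hq'))
        (fun c hc => hbs c (by simp [hc]))
      obtain ⟨rs, hlen, hrs, hreg⟩ := hdepth
      have hge := length_le_ringKrullDim_quotient_of_isAssociatedPrime rs hrs hreg hp
      have : ((bs.length + 1 : ℕ) : WithBot ℕ∞) ≤ (bs.length : ℕ) := by
        simpa [hlen] using hge.trans hle
      have : bs.length + 1 ≤ bs.length := by exact_mod_cast this
      omega
    refine (isWeaklyRegular_cons_iff M b bs).mpr ⟨hb, ih (fun c hc => hbs c (by simp [hc])) ?_ ?_⟩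
    · exact exists_isRegular_quotSMulTop hdepth hb (hbs b (by simp))
    · intro q hq hann hq'
      refine hsop q hq (le_trans ?_ hann) ?_
      · exact LinearMap.annihilator_le_of_surjective (Submodule.mkQ _)
          (Submodule.mkQ_surjective _)
      · have : b ∈ q := by
          refine hann (Module.mem_annihilator.mpr fun m => ?_)
          obtain ⟨m, rfl⟩ := Submodule.mkQ_surjective _ m
          rw [← map_smul, Submodule.mkQ_apply, Submodule.Quotient.mk_eq_zero]
          exact Submodule.smul_mem_pointwise_smul _ _ _ trivial
        simpa [this] using hq'

end LocalAlgebra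


section Graded

variable {K : Type*} [Field K] {n : ℕ} (w : Fin n → ℕ)

/-- The sum of the weighted homogeneous components of weight less than `k`. -/
noncomputable def weightedTruncation (k : ℕ) : MvPolynomial (Fin n) K →ₗ[K] MvPolynomial (Fin n) K :=
  ∑ i ∈ Finset.range k, weightedHomogeneousComponent w i

variable {w}

lemma weightedTruncation_of_isWeightedHomogeneous {p : MvPolynomial (Fin n) K} {j : ℕ}
    (hp : IsWeightedHomogeneous w p j) (k : ℕ) :
    weightedTruncation w k p = if j < k then p else 0 := by
  simp [weightedTruncation, weightedHomogeneousComponent_of_mem hp]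

lemma weightedTruncation_mul {g : MvPolynomial (Fin n) K} {e : ℕ}
    (hg : IsWeightedHomogeneous w g e) (k : ℕ) (p : MvPolynomial (Fin n) K) :
    weightedTruncation w k (g * p) = g * weightedTruncation w (k - e) p := by
  induction p using MvPolynomial.induction_on' with
  | monomial u a =>
    have hu := isWeightedHomogeneous_monomial w u a rfl
    rw [weightedTruncation_of_isWeightedHomogeneous hu,
      weightedTruncation_of_isWeightedHomogeneous (hg.mul hu)]
    have : e + Finsupp.weight w u < k ↔ Finsupp.weight w u < k - e := by omega
    simp [this]
  | add p q hp hq => simp [mul_add, hp, hq]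

lemma weightedHomogeneousComponent_mul {g : MvPolynomial (Fin n) K} {e : ℕ}
    (hg : IsWeightedHomogeneous w g e) (k : ℕ) (p : MvPolynomial (Fin n) K) :
    weightedHomogeneousComponent w (k + e) (g * p) = g * weightedHomogeneousComponent w k p := by
  induction p using MvPolynomial.induction_on' with
  | monomial u a =>
    have hu := isWeightedHomogeneous_monomial w u a rfl
    rw [weightedHomogeneousComponent_of_mem hu, weightedHomogeneousComponent_of_mem (hg.mul hu)]
    have : k + e = e + Finsupp.weight w u ↔ k = Finsupp.weight w u := by omega
    simp [this]
  | add p q hp hq => simp [mul_add, hp, hq]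

lemma weightedTruncation_idem (k : ℕ) (p : MvPolynomial (Fin n) K) :
    weightedTruncation w k (weightedTruncation w k p) = weightedTruncation w k p := by
  conv_lhs => rw [weightedTruncation, ← weightedTruncation]
  conv_lhs =>
    arg 2
    rw [weightedTruncation, LinearMap.sum_apply]
  rw [map_sum]
  conv_rhs => rw [weightedTruncation, LinearMap.sum_apply]
  refine Finset.sum_congr rfl fun i hi => ?_
  rw [weightedTruncation_of_isWeightedHomogeneous
    (weightedHomogeneousComponent_isWeightedHomogeneous i p), if_pos (Finset.mem_range.mp hi)]

lemma exists_weightedTruncation_eq_self (p : MvPolynomial (Fin n) K) :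
    ∃ k₀, ∀ k, k₀ ≤ k → weightedTruncation w k p = p := by
  induction p using MvPolynomial.induction_on' with
  | monomial u a =>
    refine ⟨Finsupp.weight w u + 1, fun k hk => ?_⟩
    rw [weightedTruncation_of_isWeightedHomogeneous (isWeightedHomogeneous_monomial w u a rfl),
      if_pos (by omega)]
  | add p q hp hq =>
    obtain ⟨a, ha⟩ := hp
    obtain ⟨b, hb⟩ := hq
    exact ⟨max a b, fun k hk => by
      rw [map_add, ha k (le_of_max_le_left hk), hb k (le_of_max_le_right hk)]⟩

lemma finite_range_weightedTruncation (hw : ∀ i, 0 < w i) (k : ℕ) :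
    Module.Finite K (LinearMap.range (weightedTruncation (K := K) w k)) := by
  have hfg : (⨆ i ∈ Finset.range k, weightedHomogeneousSubmodule K w i).FG :=
    Submodule.fg_biSup _ _ fun i _ => weightedHomogeneousSubmodule_fg K w (fun x => (hw x).ne') i
  have := Module.Finite.iff_fg.mpr hfg
  refine Submodule.finiteDimensional_of_le (S₂ := ⨆ i ∈ Finset.range k,
    weightedHomogeneousSubmodule K w i) ?_
  rintro _ ⟨p, rfl⟩
  rw [weightedTruncation, LinearMap.sum_apply]
  refine Submodule.sum_mem _ fun i hi => ?_
  exact Submodule.mem_iSup_of_mem i (Submodule.mem_iSup_of_mem hi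
    (weightedHomogeneousComponent_mem w p i))

attribute [local instance] MvPolynomial.weightedGradedAlgebra

lemma isHomogeneous_span_image {g : ℕ → MvPolynomial (Fin n) K} {e : ℕ → ℕ} {k : ℕ}
    (hg : ∀ i < k, IsWeightedHomogeneous w (g i) (e i)) :
    (Ideal.span (g '' Set.Iio k)).IsHomogeneous (weightedHomogeneousSubmodule K w) := by
  refine Ideal.homogeneous_span _ _ ?_
  rintro _ ⟨i, hi, rfl⟩
  exact ⟨e i, hg i hi⟩

lemma weightedTruncation_mem {J : Ideal (MvPolynomial (Fin n) K)}
    (hJ : J.IsHomogeneous (weightedHomogeneousSubmodule K w)) (k : ℕ)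
    {p : MvPolynomial (Fin n) K} (hp : p ∈ J) : weightedTruncation w k p ∈ J := by
  rw [weightedTruncation, LinearMap.sum_apply]
  exact J.sum_mem fun i _ => weightedHomogeneousComponent_mem_of_mem K w hJ hp i

variable (w) in
/-- The image in the quotient by `J` of the polynomials of weight less than `k`. -/
noncomputable def quotientFiltration (J : Ideal (MvPolynomial (Fin n) K)) (k : ℕ) :
    Submodule K (MvPolynomial (Fin n) K ⧸ J) :=
  (LinearMap.range (weightedTruncation w k)).map (Ideal.Quotient.mkₐ K J).toLinearMap

lemma finite_quotientFiltration (hw : ∀ i, 0 < w i) (J : Ideal (MvPolynomial (Fin n) K)) (k : ℕ) :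
    Module.Finite K (quotientFiltration w J k) := by
  have := finite_range_weightedTruncation (K := K) hw k
  exact Module.Finite.map _ _

lemma mem_quotientFiltration {J : Ideal (MvPolynomial (Fin n) K)} {k : ℕ}
    {x : MvPolynomial (Fin n) K ⧸ J} :
    x ∈ quotientFiltration w J k ↔ ∃ p, Ideal.Quotient.mk J (weightedTruncation w k p) = x := by
  simp [quotientFiltration]

lemma finrank_quotientFiltration_sup_span_singleton (hw : ∀ i, 0 < w i)
    {J J' : Ideal (MvPolynomial (Fin n) K)}
    (hJ : J.IsHomogeneous (weightedHomogeneousSubmodule K w))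
    {g : MvPolynomial (Fin n) K} {e : ℕ} (hg : IsWeightedHomogeneous w g e)
    (hreg : ∀ p, g * p ∈ J → p ∈ J) (hJ' : J' = J ⊔ Ideal.span {g}) (k : ℕ) :
    Module.finrank K (quotientFiltration w J' k) + Module.finrank K (quotientFiltration w J (k - e))
      = Module.finrank K (quotientFiltration w J k) := by
  have := finite_quotientFiltration hw J k
  have hle : J ≤ J' := hJ' ▸ le_sup_left
  let π : (MvPolynomial (Fin n) K ⧸ J) →ₗ[K] (MvPolynomial (Fin n) K ⧸ J') :=
    (Ideal.Quotient.factorₐ K hle).toLinearMap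
  have hπ : ∀ p, π (Ideal.Quotient.mk J p) = Ideal.Quotient.mk J' p := fun p => rfl
  let μ : (MvPolynomial (Fin n) K ⧸ J) →ₗ[K] (MvPolynomial (Fin n) K ⧸ J) :=
    LinearMap.mulLeft K (Ideal.Quotient.mk J g)
  have hμ : ∀ p, μ (Ideal.Quotient.mk J p) = Ideal.Quotient.mk J (g * p) := fun p => by
    simp [μ]
  have hμinj : Function.Injective μ := by
    rw [← LinearMap.ker_eq_bot, LinearMap.ker_eq_bot']
    intro x hx
    obtain ⟨p, rfl⟩ := Ideal.Quotient.mk_surjective x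
    rw [hμ, Ideal.Quotient.eq_zero_iff_mem] at hx
    exact Ideal.Quotient.eq_zero_iff_mem.mpr (hreg p hx)
  have hrange : LinearMap.range (π.domRestrict (quotientFiltration w J k))
      = quotientFiltration w J' k := by
    ext x
    simp only [LinearMap.mem_range, LinearMap.domRestrict_apply, Subtype.exists,
      mem_quotientFiltration]
    constructor
    · rintro ⟨_, ⟨p, rfl⟩, rfl⟩
      exact ⟨p, rfl⟩
    · rintro ⟨p, rfl⟩
      exact ⟨_, ⟨p, rfl⟩, rfl⟩
  have hker : (LinearMap.ker (π.domRestrict (quotientFiltration w J k))).map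
      (quotientFiltration w J k).subtype = (quotientFiltration w J (k - e)).map μ := by
    ext x
    simp only [Submodule.mem_map, LinearMap.mem_ker, LinearMap.domRestrict_apply, Subtype.exists,
      mem_quotientFiltration, Submodule.subtype_apply]
    constructor
    · rintro ⟨_, ⟨p, rfl⟩, hx, rfl⟩
      simp only [hπ] at hx
      rw [Ideal.Quotient.eq_zero_iff_mem, hJ', Submodule.mem_sup] at hx
      obtain ⟨j, hj, _, hq, hsum⟩ := hx
      obtain ⟨q, rfl⟩ := Ideal.mem_span_singleton'.mp hq
      refine ⟨_, ⟨q, rfl⟩, ?_⟩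
      rw [hμ, ← weightedTruncation_mul hg, ← weightedTruncation_idem k p, ← hsum, map_add, mul_comm,
        map_add, Ideal.Quotient.eq_zero_iff_mem.mpr (weightedTruncation_mem hJ k hj), zero_add]
    · rintro ⟨_, ⟨p, rfl⟩, rfl⟩
      refine ⟨_, ⟨g * p, rfl⟩, ?_, ?_⟩
      · simp only [hπ]
        rw [weightedTruncation_mul hg, Ideal.Quotient.eq_zero_iff_mem, hJ']
        exact Ideal.mul_mem_right _ _ (Submodule.mem_sup_right (Ideal.mem_span_singleton_self g))
      · rw [hμ, weightedTruncation_mul hg]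
  have h1 := LinearMap.finrank_range_add_finrank_ker (π.domRestrict (quotientFiltration w J k))
  rw [hrange] at h1
  rw [← h1, (Submodule.equivMapOfInjective μ hμinj _).finrank_eq, ← hker,
    (Submodule.equivMapOfInjective _ (Submodule.injective_subtype _) _).finrank_eq]

lemma exists_finrank_quotientFiltration_eq (J : Ideal (MvPolynomial (Fin n) K))
    [Module.Finite K (MvPolynomial (Fin n) K ⧸ J)] :
    ∃ k₀, ∀ k, k₀ ≤ k → Module.finrank K (quotientFiltration w J k) =
      Module.finrank K (MvPolynomial (Fin n) K ⧸ J) := by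
  obtain ⟨s, hs⟩ := Module.Finite.fg_top (R := K) (M := MvPolynomial (Fin n) K ⧸ J)
  have h : ∀ x : MvPolynomial (Fin n) K ⧸ J, ∃ k₀, ∀ k, k₀ ≤ k → x ∈ quotientFiltration w J k := by
    intro x
    obtain ⟨p, rfl⟩ := Ideal.Quotient.mk_surjective x
    obtain ⟨k₀, hk₀⟩ := exists_weightedTruncation_eq_self (w := w) p
    exact ⟨k₀, fun k hk => mem_quotientFiltration.mpr ⟨p, by rw [hk₀ k hk]⟩⟩
  choose κ hκ using h
  refine ⟨s.sup κ, fun k hk => ?_⟩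
  have : quotientFiltration w J k = ⊤ := by
    rw [eq_top_iff, ← hs, Submodule.span_le]
    exact fun x hx => hκ x k ((Finset.le_sup hx).trans hk)
  rw [this, finrank_top]

/-- The generating function of the dimensions of the filtration of the quotient by `J`. -/
noncomputable def hilbertSeries (w : Fin n → ℕ) (J : Ideal (MvPolynomial (Fin n) K)) :
    PowerSeries ℤ :=
  PowerSeries.mk fun k => (Module.finrank K (quotientFiltration w J k) : ℤ)

lemma finrank_quotientFiltration_zero (J : Ideal (MvPolynomial (Fin n) K)) :
    Module.finrank K (quotientFiltration w J 0) = 0 := by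
  have : quotientFiltration w J 0 = ⊥ := by
    rw [eq_bot_iff]
    intro x hx
    obtain ⟨p, rfl⟩ := mem_quotientFiltration.mp hx
    simp [weightedTruncation]
  rw [this, finrank_bot]

lemma hilbertSeries_sup_span_singleton (hw : ∀ i, 0 < w i)
    {J J' : Ideal (MvPolynomial (Fin n) K)}
    (hJ : J.IsHomogeneous (weightedHomogeneousSubmodule K w))
    {g : MvPolynomial (Fin n) K} {e : ℕ} (hg : IsWeightedHomogeneous w g e)
    (hreg : ∀ p, g * p ∈ J → p ∈ J) (hJ' : J' = J ⊔ Ideal.span {g}) :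
    hilbertSeries w J' = (1 - PowerSeries.X ^ e) * hilbertSeries w J := by
  ext k
  have h := finrank_quotientFiltration_sup_span_singleton hw hJ hg hreg hJ' k
  rw [sub_mul, one_mul, map_sub, PowerSeries.coeff_X_pow_mul']
  simp only [hilbertSeries, PowerSeries.coeff_mk]
  split_ifs with hk
  · omega
  · rw [Nat.sub_eq_zero_of_le (by omega), finrank_quotientFiltration_zero] at h
    omega

lemma span_image_Iio_succ {A : Type*} [CommRing A] (g : ℕ → A) (k : ℕ) :
    Ideal.span (g '' Set.Iio (k + 1)) = Ideal.span (g '' Set.Iio k) ⊔ Ideal.span {g k} := by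
  rw [← Ideal.span_union]
  congr 1
  rw [← Set.image_singleton, ← Set.image_union]
  congr 1
  ext i
  simp

lemma hilbertSeries_span_image (hw : ∀ i, 0 < w i) {m : ℕ} {g : ℕ → MvPolynomial (Fin n) K}
    {e : ℕ → ℕ} (hg : ∀ i < m, IsWeightedHomogeneous w (g i) (e i))
    (hreg : ∀ i < m, ∀ p, g i * p ∈ Ideal.span (g '' Set.Iio i) →
      p ∈ Ideal.span (g '' Set.Iio i)) :
    hilbertSeries w (Ideal.span (g '' Set.Iio m)) =
      (∏ i ∈ Finset.range m, (1 - PowerSeries.X ^ e i)) *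
        hilbertSeries w (⊥ : Ideal (MvPolynomial (Fin n) K)) := by
  induction m with
  | zero => simp
  | succ m ih =>
    rw [hilbertSeries_sup_span_singleton hw (isHomogeneous_span_image fun i hi => hg i (by omega))
      (hg m (by omega)) (hreg m (by omega)) (span_image_Iio_succ g m),
      ih (fun i hi => hg i (by omega)) (fun i hi => hreg i (by omega)), Finset.prod_range_succ]
    ring

lemma exists_mk_mul_one_sub_X_eq (s : ℕ → ℤ) (D : ℤ) (k₀ : ℕ)
    (hs : ∀ k, k₀ ≤ k → s k = D) :
    ∃ p : Polynomial ℤ, p.eval 1 = D ∧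
      PowerSeries.mk s * (1 - PowerSeries.X) = (p : PowerSeries ℤ) := by
  refine ⟨Polynomial.C D - (∑ i ∈ Finset.range k₀, Polynomial.monomial i (D - s i)) *
    (1 - Polynomial.X), by simp, ?_⟩
  have h : PowerSeries.mk s = PowerSeries.C D * PowerSeries.mk 1 -
      ((∑ i ∈ Finset.range k₀, Polynomial.monomial i (D - s i) : Polynomial ℤ) :
        PowerSeries ℤ) := by
    ext k
    rw [map_sub]
    simp only [PowerSeries.coeff_mk, PowerSeries.coeff_C_mul, Pi.one_apply, mul_one,
      Polynomial.coeff_coe, Polynomial.finsetSum_coeff, Polynomial.coeff_monomial,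
      Finset.sum_ite_eq', Finset.mem_range]
    split_ifs with hk
    · ring
    · rw [hs k (by omega)]; ring
  rw [h, sub_mul, mul_assoc, PowerSeries.mk_one_mul_one_sub_eq_one]
  push_cast
  simp

lemma prod_one_sub_X_pow (e : ℕ → ℕ) (n : ℕ) :
    ∏ i ∈ Finset.range n, (1 - Polynomial.X ^ e i : Polynomial ℤ) =
      (1 - Polynomial.X) ^ n *
        ∏ i ∈ Finset.range n, ∑ j ∈ Finset.range (e i), Polynomial.X ^ j := by
  conv_rhs => rw [← Finset.card_range n, ← Finset.prod_const, Finset.card_range,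
    ← Finset.prod_mul_distrib]
  exact Finset.prod_congr rfl fun i _ => (mul_neg_geom_sum _ _).symm

/-- For homogeneous regular sequences of the same length with finite-dimensional quotients, the
dimensions of the quotients are proportional to the products of the weights. -/
lemma prod_mul_finrank_quotient_eq (hw : ∀ i, 0 < w i) {m : ℕ}
    {g x : ℕ → MvPolynomial (Fin n) K} {e v : ℕ → ℕ}
    (hg : ∀ i < m, IsWeightedHomogeneous w (g i) (e i))
    (hgreg : ∀ i < m, ∀ p, g i * p ∈ Ideal.span (g '' Set.Iio i) →
      p ∈ Ideal.span (g '' Set.Iio i))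
    (hx : ∀ i < m, IsWeightedHomogeneous w (x i) (v i))
    (hxreg : ∀ i < m, ∀ p, x i * p ∈ Ideal.span (x '' Set.Iio i) →
      p ∈ Ideal.span (x '' Set.Iio i))
    [Module.Finite K (MvPolynomial (Fin n) K ⧸ Ideal.span (g '' Set.Iio m))]
    [Module.Finite K (MvPolynomial (Fin n) K ⧸ Ideal.span (x '' Set.Iio m))] :
    (∏ i ∈ Finset.range m, v i) *
        Module.finrank K (MvPolynomial (Fin n) K ⧸ Ideal.span (g '' Set.Iio m)) =
      (∏ i ∈ Finset.range m, e i) *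
        Module.finrank K (MvPolynomial (Fin n) K ⧸ Ideal.span (x '' Set.Iio m)) := by
  obtain ⟨kg, hkg⟩ := exists_finrank_quotientFiltration_eq (w := w) (Ideal.span (g '' Set.Iio m))
  obtain ⟨kx, hkx⟩ := exists_finrank_quotientFiltration_eq (w := w) (Ideal.span (x '' Set.Iio m))
  obtain ⟨pg, hpg1, hpg⟩ := exists_mk_mul_one_sub_X_eq
    (fun k => (Module.finrank K (quotientFiltration w (Ideal.span (g '' Set.Iio m)) k) : ℤ)) _ kg
    (fun k hk => congrArg _ (hkg k hk))
  obtain ⟨px, hpx1, hpx⟩ := exists_mk_mul_one_sub_X_eq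
    (fun k => (Module.finrank K (quotientFiltration w (Ideal.span (x '' Set.Iio m)) k) : ℤ)) _ kx
    (fun k hk => congrArg _ (hkx k hk))
  have hHg := hilbertSeries_span_image hw hg hgreg
  have hHx := hilbertSeries_span_image hw hx hxreg
  have hpoly : (∏ i ∈ Finset.range m, (1 - Polynomial.X ^ v i : Polynomial ℤ)) * pg =
      (∏ i ∈ Finset.range m, (1 - Polynomial.X ^ e i)) * px := by
    have hcoe : ∀ u : ℕ → ℕ, ((∏ i ∈ Finset.range m, (1 - Polynomial.X ^ u i) : Polynomial ℤ) :
        PowerSeries ℤ) = ∏ i ∈ Finset.range m, (1 - PowerSeries.X ^ u i) := by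
      intro u
      rw [← Polynomial.coeToPowerSeries.ringHom_apply, map_prod]
      simp
    apply Polynomial.coe_injective
    rw [Polynomial.coe_mul, Polynomial.coe_mul, hcoe, hcoe, ← hpg, ← hpx]
    change _ * (hilbertSeries w _ * _) = _ * (hilbertSeries w _ * _)
    rw [hHg, hHx]
    ring
  rw [prod_one_sub_X_pow, prod_one_sub_X_pow, mul_assoc, mul_assoc] at hpoly
  have hne : (1 - Polynomial.X : Polynomial ℤ) ≠ 0 := by
    intro h
    simpa using congrArg (Polynomial.eval 0) h
  have h := congrArg (Polynomial.eval 1) (mul_left_cancel₀ (pow_ne_zero m hne) hpoly)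
  simp only [Polynomial.eval_mul, Polynomial.eval_prod, Polynomial.eval_finsetSum,
    Polynomial.eval_pow, Polynomial.eval_X, one_pow, Finset.sum_const, Finset.card_range,
    nsmul_eq_mul, mul_one, hpg1, hpx1] at h
  exact_mod_cast h

end Graded


lemma isWeaklyRegular_map_range_iff {A : Type*} [CommRing A] (g : ℕ → A) (k : ℕ) :
    RingTheory.Sequence.IsWeaklyRegular A ((List.range k).map g) ↔
      ∀ i < k, ∀ p, g i * p ∈ Ideal.span (g '' Set.Iio i) → p ∈ Ideal.span (g '' Set.Iio i) := by
  have h : ∀ i < k, (Ideal.ofList (((List.range k).map g).take i) • ⊤ : Ideal A) =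
      Ideal.span (g '' Set.Iio i) := by
    intro i hi
    rw [smul_eq_mul, Ideal.mul_top, ← List.map_take, List.take_range, min_eq_left hi.le,
      Ideal.ofList]
    congr 1
    ext x
    simp
  rw [RingTheory.Sequence.isWeaklyRegular_iff]
  refine ⟨fun H i hi => ?_, fun H i hi => ?_⟩
  · have := (isSMulRegular_quotient_iff_mem_of_smul_mem _ _).mp (H i (by simpa using hi))
    rw [h i hi] at this
    simpa using this
  · have hi' : i < k := by simpa using hi
    rw [isSMulRegular_quotient_iff_mem_of_smul_mem, h i hi']
    simpa using H i hi'

section Variables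

variable (K : Type*) [Field K] (n : ℕ)

/-- The variables, as a sequence indexed by `ℕ` which vanishes from `n` on. -/
noncomputable def variableSeq (i : ℕ) : MvPolynomial (Fin n) K :=
  if h : i < n then X ⟨i, h⟩ else 0

variable {n}

lemma span_variableSeq_image {i : ℕ} (hi : i ≤ n) :
    Ideal.span (variableSeq K n '' Set.Iio i) =
      Ideal.span (X '' {j : Fin n | (j : ℕ) < i}) := by
  congr 1
  ext p
  simp only [Set.mem_image, Set.mem_Iio, Set.mem_ofPred_eq]
  constructor
  · rintro ⟨j, hj, rfl⟩
    exact ⟨⟨j, by omega⟩, hj, by simp [variableSeq, hj.trans_le hi]⟩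
  · rintro ⟨j, hj, rfl⟩
    exact ⟨j, hj, by simp [variableSeq]⟩

lemma variableSeq_mul_mem {i : ℕ} (hi : i < n) (p : MvPolynomial (Fin n) K)
    (hp : variableSeq K n i * p ∈ Ideal.span (variableSeq K n '' Set.Iio i)) :
    p ∈ Ideal.span (variableSeq K n '' Set.Iio i) := by
  rw [span_variableSeq_image K hi.le, mem_ideal_span_X_image] at hp ⊢
  simp only [variableSeq, hi, dite_true] at hp
  intro m hm
  obtain ⟨j, hj, hne⟩ := hp (Finsupp.single ⟨i, hi⟩ 1 + m) (by
    rw [mem_support_iff, coeff_X_mul]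
    exact mem_support_iff.mp hm)
  have hj' : (j : ℕ) < i := hj
  refine ⟨j, hj, ?_⟩
  rwa [Finsupp.add_apply, Finsupp.single_eq_of_ne (by
    rintro rfl
    exact lt_irrefl _ hj'), zero_add] at hne

lemma span_variableSeq : Ideal.span (variableSeq K n '' Set.Iio n) =
    RingHom.ker (constantCoeff (R := K) (σ := Fin n)) := by
  rw [span_variableSeq_image K le_rfl]
  ext p
  rw [mem_ideal_span_X_image, RingHom.mem_ker, constantCoeff_eq]
  constructor
  · intro h
    by_contra h0
    obtain ⟨j, -, hj⟩ := h 0 (mem_support_iff.mpr h0)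
    simp at hj
  · intro h m hm
    have : m ≠ 0 := by
      rintro rfl
      exact mem_support_iff.mp hm h
    obtain ⟨j, hj⟩ := Finsupp.ne_iff.mp this
    exact ⟨j, j.isLt, hj⟩

lemma variableSeq_mem_ker {i : ℕ} :
    variableSeq K n i ∈ RingHom.ker (constantCoeff (R := K) (σ := Fin n)) := by
  rw [RingHom.mem_ker, variableSeq]
  split_ifs <;> simp

/-- The quotient by the ideal of the variables is the base field. -/
noncomputable def quotientVariableSeqEquiv :
    (MvPolynomial (Fin n) K ⧸ Ideal.span (variableSeq K n '' Set.Iio n)) ≃ₐ[K] K :=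
  (Ideal.quotientEquivAlgOfEq K (by
    rw [span_variableSeq]
    ext p
    simp [RingHom.mem_ker, aeval_zero'])).trans
    (Ideal.quotientKerAlgEquivOfSurjective (f := (aeval (fun _ : Fin n => (0 : K))))
      fun c => ⟨C c, by simp⟩)

end Variables

section HomogeneousSequence

variable {K : Type*} [Field K] {n : ℕ} {w : Fin n → ℕ}

attribute [local instance] MvPolynomial.weightedGradedAlgebra

lemma mem_ker_constantCoeff_of_isWeightedHomogeneous {p : MvPolynomial (Fin n) K} {e : ℕ}
    (hp : IsWeightedHomogeneous w p e) (he : 0 < e) :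
    p ∈ RingHom.ker (constantCoeff (R := K) (σ := Fin n)) := by
  rw [RingHom.mem_ker, constantCoeff_eq]
  exact hp.coeff_eq_zero 0 (by simpa using he.ne)

lemma mem_of_mul_mem_of_constantCoeff_ne_zero (hw : ∀ i, 0 < w i)
    {J : Ideal (MvPolynomial (Fin n) K)}
    (hJ : J.IsHomogeneous (weightedHomogeneousSubmodule K w))
    {p s : MvPolynomial (Fin n) K} {k : ℕ} (hp : IsWeightedHomogeneous w p k)
    (hs : constantCoeff s ≠ 0) (h : s * p ∈ J) : p ∈ J := by
  have h0 := weightedHomogeneousComponent_mem_of_mem K w hJ h (0 + k)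
  rw [mul_comm s, weightedHomogeneousComponent_mul hp,
    weightedHomogeneousComponent_zero _ fun i => (hw i).ne'] at h0
  have := J.mul_mem_right (C (constantCoeff s)⁻¹) h0
  rwa [mul_assoc, ← C_mul, ← constantCoeff_eq, mul_inv_cancel₀ hs, C_1, mul_one] at this

/-- Homogeneous elements of positive weight, as many as there are variables, form a regular
sequence if they have a finite-dimensional quotient. -/
theorem mem_span_image_of_mul_mem (hw : ∀ i, 0 < w i) {g : ℕ → MvPolynomial (Fin n) K}
    {e : ℕ → ℕ} (hg : ∀ i < n, IsWeightedHomogeneous w (g i) (e i)) (he : ∀ i < n, 0 < e i)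
    [Module.Finite K (MvPolynomial (Fin n) K ⧸ Ideal.span (g '' Set.Iio n))] {i : ℕ} (hi : i < n)
    (p : MvPolynomial (Fin n) K) (hp : g i * p ∈ Ideal.span (g '' Set.Iio i)) :
    p ∈ Ideal.span (g '' Set.Iio i) := by
  let m : Ideal (MvPolynomial (Fin n) K) := RingHom.ker (constantCoeff (R := K) (σ := Fin n))
  have hm : m.IsPrime := RingHom.ker_isPrime _
  let S := Localization.AtPrime m
  have hgm : ∀ i < n, g i ∈ m := fun i hi =>
    mem_ker_constantCoeff_of_isWeightedHomogeneous (hg i hi) (he i hi)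
  have : IsNoetherianRing S := IsLocalization.isNoetherianRing m.primeCompl S inferInstance
  have hmax : ∀ a ∈ m, algebraMap (MvPolynomial (Fin n) K) S a ∈ IsLocalRing.maximalIdeal S :=
   fun a ha =>
    (IsLocalization.AtPrime.to_map_mem_maximal_iff S m a).mpr ha
  have hS : RingTheory.Sequence.IsWeaklyRegular S
      ((List.range n).map fun i => algebraMap (MvPolynomial (Fin n) K) S (g i)) := by
    apply isWeaklyRegular_of_forall_eq_maximalIdeal
    · simpa using fun i hi => hmax _ (hgm i hi)
    · refine ⟨((List.range n).map (variableSeq K n)).map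
        (algebraMap (MvPolynomial (Fin n) K) S), by simp, ?_, ?_⟩
      · simpa using fun i _ => hmax _ (variableSeq_mem_ker K)
      · refine ((isWeaklyRegular_map_range_iff _ _).mpr fun i hi => variableSeq_mul_mem K hi
          ).isRegular_of_isLocalization_of_mem S m ?_
        intro r hr
        obtain ⟨j, -, rfl⟩ := List.mem_map.mp hr
        exact variableSeq_mem_ker K
    · intro q hq _ hgq
      have hJq : Ideal.span (g '' Set.Iio n) ≤ q.comap (algebraMap (MvPolynomial (Fin n) K) S) := by
        rw [Ideal.span_le]
        rintro _ ⟨j, hj, rfl⟩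
        exact hgq _ (List.mem_map.mpr ⟨j, List.mem_range.mpr hj, rfl⟩)
      have hqm : q.comap (algebraMap (MvPolynomial (Fin n) K) S) ≤ m := by
        intro a ha
        exact (IsLocalization.AtPrime.to_map_mem_maximal_iff S m a).mp
          (IsLocalRing.le_maximalIdeal hq.ne_top ha)
      have hqp : (q.comap (algebraMap (MvPolynomial (Fin n) K) S)).IsPrime := Ideal.comap_isPrime _ _
      have hqmax : (q.comap (algebraMap (MvPolynomial (Fin n) K) S)).IsMaximal := by
        have hfin : Module.Finite K
            (MvPolynomial (Fin n) K ⧸ q.comap (algebraMap (MvPolynomial (Fin n) K) S)) :=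
          Module.Finite.of_surjective (Ideal.Quotient.factorₐ K hJq).toLinearMap
            (Ideal.Quotient.factor_surjective hJq)
        have : IsArtinianRing
            (MvPolynomial (Fin n) K ⧸ q.comap (algebraMap (MvPolynomial (Fin n) K) S)) :=
          IsArtinianRing.of_finite K _
        exact Ideal.Quotient.maximal_of_isField _ (IsArtinianRing.isField_of_isDomain _)
      have heq : q.comap (algebraMap (MvPolynomial (Fin n) K) S) = m := hqmax.eq_of_le hm.ne_top hqm
      rw [← IsLocalization.map_under m.primeCompl S q, ← IsLocalization.map_under m.primeCompl S
        (IsLocalRing.maximalIdeal S), IsLocalization.AtPrime.under_maximalIdeal S m]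
      exact congrArg _ heq
  rw [isWeaklyRegular_map_range_iff] at hS
  have hmap : Ideal.span ((fun i => algebraMap (MvPolynomial (Fin n) K) S (g i)) '' Set.Iio i) =
      (Ideal.span (g '' Set.Iio i)).map (algebraMap (MvPolynomial (Fin n) K) S) := by
    rw [Ideal.map_span, Set.image_image]
  have hJ := isHomogeneous_span_image (k := i) fun j hj => hg j (hj.trans hi)
  rw [mem_iff_weightedHomogeneousComponent_mem K w hJ]
  intro k
  have hk := weightedHomogeneousComponent_mem_of_mem K w hJ hp (k + e i)
  rw [weightedHomogeneousComponent_mul (hg i hi)] at hk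
  have hk' := hS i hi (algebraMap (MvPolynomial (Fin n) K) S (weightedHomogeneousComponent w k p)) (by
    rw [hmap, ← map_mul]
    exact Ideal.mem_map_of_mem _ hk)
  rw [hmap, IsLocalization.algebraMap_mem_map_algebraMap_iff m.primeCompl] at hk'
  obtain ⟨s, hs, hsp⟩ := hk'
  exact mem_of_mul_mem_of_constantCoeff_ne_zero hw hJ
    (weightedHomogeneousComponent_isWeightedHomogeneous k p) hs hsp

/-- The weighted Bézout formula: for `n` homogeneous polynomials in `n` variables with a
finite-dimensional quotient, its dimension is determined by the weights. -/
theorem prod_weight_mul_finrank_quotient_eq (hw : ∀ i, 0 < w i)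
    {g : Fin n → MvPolynomial (Fin n) K} {e : Fin n → ℕ}
    (hg : ∀ i, IsWeightedHomogeneous w (g i) (e i)) (he : ∀ i, 0 < e i)
    [Module.Finite K (MvPolynomial (Fin n) K ⧸ Ideal.span (Set.range g))] :
    (∏ i, w i) * Module.finrank K (MvPolynomial (Fin n) K ⧸ Ideal.span (Set.range g)) =
      ∏ i, e i := by
  let g' : ℕ → MvPolynomial (Fin n) K := fun i => if h : i < n then g ⟨i, h⟩ else 0
  have hspan : Ideal.span (Set.range g) = Ideal.span (g' '' Set.Iio n) := by
    congr 1
    ext p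
    simp only [Set.mem_range, Set.mem_image, Set.mem_Iio]
    constructor
    · rintro ⟨j, rfl⟩
      exact ⟨j, j.isLt, by simp [g']⟩
    · rintro ⟨j, hj, rfl⟩
      exact ⟨⟨j, hj⟩, by simp [g', hj]⟩
  have hfin : Module.Finite K (MvPolynomial (Fin n) K ⧸ Ideal.span (g' '' Set.Iio n)) := by
    rwa [← hspan]
  have hfinX : Module.Finite K
      (MvPolynomial (Fin n) K ⧸ Ideal.span (variableSeq K n '' Set.Iio n)) :=
    Module.Finite.equiv (quotientVariableSeqEquiv K).symm.toLinearEquiv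
  have hg' : ∀ i < n, IsWeightedHomogeneous w (g' i) (if h : i < n then e ⟨i, h⟩ else 0) :=
    fun i hi => by simpa [g', hi] using hg ⟨i, hi⟩
  have hX : ∀ i < n, IsWeightedHomogeneous w (variableSeq K n i)
      (if h : i < n then w ⟨i, h⟩ else 0) :=
    fun i hi => by simpa [variableSeq, hi] using isWeightedHomogeneous_X K w ⟨i, hi⟩
  have := prod_mul_finrank_quotient_eq hw hg'
    (fun i hi => mem_span_image_of_mul_mem hw hg' (fun i hi => by simpa [hi] using he ⟨i, hi⟩) hi)
    hX (fun i hi => variableSeq_mul_mem K hi)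
  rw [(quotientVariableSeqEquiv K).toLinearEquiv.finrank_eq, Module.finrank_self, mul_one,
    Finset.prod_range, Finset.prod_range] at this
  rw [hspan]
  simpa using this

end HomogeneousSequence

/-- For a weighted homogeneous polynomial `f` of degree `d` (weights `w i`,
`2 w i ≤ d`) with an isolated singularity at `0`, the dimension of the Milnor algebra
`Q = ℂ[x]/J(f)` satisfies `(∏ᵢ wᵢ) · dim_ℂ Q = ∏ᵢ (d − wᵢ)`. -/
theorem stmt3 (n : ℕ) (hn : 1 ≤ n) (d : ℕ) (w : Fin n → ℕ)
    (hd : 0 < d) (hw : ∀ i, 0 < w i) (hwd : ∀ i, 2 * w i ≤ d)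
    (f : MvPolynomial (Fin n) ℂ)
    (hf : MvPolynomial.IsWeightedHomogeneous w f d)
    (hiso : FiniteDimensional ℂ (MvPolynomial (Fin n) ℂ ⧸ jacobianIdeal n f)) :
    (∏ i : Fin n, w i) *
        Module.finrank ℂ (MvPolynomial (Fin n) ℂ ⧸ jacobianIdeal n f) =
      ∏ i : Fin n, (d - w i) := by
  have h : Module.Finite ℂ
      (MvPolynomial (Fin n) ℂ ⧸ Ideal.span (Set.range fun i => pderiv i f)) := hiso
  refine prod_weight_mul_finrank_quotient_eq hw (fun i => hf.pderiv ?_) fun i => ?_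
  · have := hwd i
    omega
  · have := hwd i
    have := hw i
    omega
end

section
/- With the weighted-homogeneous isolated-singularity setup, for every integer k > n·d − 2·Σᵢdᵢ and every weighted homogeneous polynomial g ∈ ℂ[x₁,…,xₙ] of degree k, there exist weighted homogeneous polynomials h₁,…,hₙ with hᵢ of degree k − (d − dᵢ) such that g = Σᵢ fᵢ·hᵢ; in particular, the graded piece Q_k of the Milnor algebra vanishes for every k > n·d − 2·Σᵢdᵢ. -/
open MvPolynomial

section Koszul

variable {R ι : Type*} [CommRing R] [LinearOrder ι]

/-- The sign `(-1) ^ #{i ∈ s | i < j}`. -/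
def koszulSign (R : Type*) [CommRing R] (j : ι) (s : Finset ι) : R :=
  ∏ i ∈ s, if i < j then -1 else 1

/-- The Koszul differential `f ∧ -`, the exterior algebra on `ι → R` being identified with
`Finset ι → R`. -/
def koszulWedge (f : ι → R) (z : Finset ι → R) (s : Finset ι) : R :=
  ∑ j ∈ s, koszulSign R j s * f j * z (s.erase j)

/-- The contraction by `A`, the exterior algebra on `ι → R` being identified with
`Finset ι → R`. -/
def koszulContract [Fintype ι] (A : ι → R) (z : Finset ι → R) (s : Finset ι) : R :=
  ∑ j ∈ sᶜ, koszulSign R j s * A j * z (insert j s)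

theorem koszulSign_mul_self (j : ι) (s : Finset ι) :
    koszulSign R j s * koszulSign R j s = 1 := by
  rw [koszulSign, ← Finset.prod_mul_distrib]
  exact Finset.prod_eq_one fun i _ => by split_ifs <;> simp

theorem koszulSign_insert {l : ι} {s : Finset ι} (hl : l ∉ s) (j : ι) :
    koszulSign R j (insert l s) = (if l < j then -1 else 1) * koszulSign R j s := by
  rw [koszulSign, Finset.prod_insert hl, koszulSign]

theorem koszulSign_insert_self {j : ι} {s : Finset ι} (hj : j ∉ s) :
    koszulSign R j (insert j s) = koszulSign R j s := by
  simp [koszulSign_insert hj]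

theorem koszulSign_erase_add_insert {j l : ι} {s : Finset ι} (hj : j ∈ s) (hl : l ∉ s) :
    koszulSign R j s * koszulSign R l (s.erase j) +
      koszulSign R l s * koszulSign R j (insert l s) = 0 := by
  obtain ⟨t, hjt, rfl⟩ : ∃ t, j ∉ t ∧ insert j t = s :=
    ⟨s.erase j, Finset.notMem_erase j s, Finset.insert_erase hj⟩
  rw [Finset.erase_insert hjt, koszulSign_insert hl, koszulSign_insert_self hjt,
    koszulSign_insert hjt]
  have hne : l ≠ j := fun h => hl (h ▸ Finset.mem_insert_self _ _)
  rcases lt_or_gt_of_ne hne with h | h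
  · rw [if_pos h, if_neg h.not_gt]; ring
  · rw [if_neg h.not_gt, if_pos h]; ring

theorem koszulSign_erase_add_erase {j l : ι} {s : Finset ι} (hj : j ∈ s) (hl : l ∈ s)
    (hne : l ≠ j) :
    koszulSign R j s * koszulSign R l (s.erase j) +
      koszulSign R l s * koszulSign R j (s.erase l) = 0 := by
  obtain ⟨t, hlt, rfl⟩ : ∃ t, l ∉ t ∧ insert l t = s :=
    ⟨s.erase l, Finset.notMem_erase l s, Finset.insert_erase hl⟩
  have hjt : j ∈ t := (Finset.mem_insert.1 hj).resolve_left hne.symm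
  have h := koszulSign_erase_add_insert (R := R) hjt hlt
  rw [Finset.erase_insert hlt, koszulSign_insert_self hlt, Finset.erase_insert_of_ne hne,
    koszulSign_insert_self fun h => hlt (Finset.mem_of_mem_erase h)]
  linear_combination koszulSign R j t * koszulSign R j (insert l t) * h -
    koszulSign R j (insert l t) * koszulSign R l (t.erase j) * koszulSign_mul_self (R := R) j t -
    koszulSign R l t * koszulSign R j t * koszulSign_mul_self (R := R) j (insert l t)

theorem koszulWedge_koszulWedge (f : ι → R) (z : Finset ι → R) (s : Finset ι) :
    koszulWedge f (koszulWedge f z) s = 0 := by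
  simp only [koszulWedge, Finset.mul_sum]
  rw [Finset.sum_sigma']
  refine Finset.sum_involution (fun p _ => ⟨p.2, p.1⟩) ?_ ?_ ?_ ?_
  · rintro ⟨j, l⟩ h
    simp only [Finset.mem_sigma, Finset.mem_erase] at h
    have := koszulSign_erase_add_erase (R := R) h.1 h.2.2 h.2.1
    simp only [Finset.erase_right_comm (a := l) (b := j)]
    linear_combination (f j * f l * z ((s.erase j).erase l)) * this
  · rintro ⟨j, l⟩ h _ he
    simp only [Finset.mem_sigma, Finset.mem_erase] at h
    exact h.2.1 (congrArg Sigma.fst he)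
  · rintro ⟨j, l⟩ h
    simp only [Finset.mem_sigma, Finset.mem_erase] at h ⊢
    exact ⟨h.2.2, h.2.1.symm, h.1⟩
  · rintro ⟨j, l⟩ h
    rfl

/-- Cartan's formula: contraction by `A` is a homotopy for multiplication by `∑ j, A j * f j`. -/
theorem koszulWedge_koszulContract_add [Fintype ι] (f A : ι → R) (z : Finset ι → R)
    (s : Finset ι) :
    koszulWedge f (koszulContract A z) s + koszulContract A (koszulWedge f z) s =
      (∑ j, A j * f j) * z s := by
  have h₁ : koszulWedge f (koszulContract A z) s =
      ∑ j ∈ s, A j * f j * z s + ∑ j ∈ s, ∑ l ∈ sᶜ,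
        koszulSign R j s * koszulSign R l (s.erase j) *
          (f j * A l * z (insert l (s.erase j))) := by
    rw [← Finset.sum_add_distrib]
    refine Finset.sum_congr rfl fun j hj => ?_
    have hjs : koszulSign R j (s.erase j) = koszulSign R j s := by
      conv_rhs => rw [← Finset.insert_erase hj]
      exact (koszulSign_insert_self (Finset.notMem_erase j s)).symm
    rw [koszulContract, Finset.compl_erase, Finset.sum_insert (by simpa using hj), mul_add,
      Finset.insert_erase hj, hjs, Finset.mul_sum]
    congr 1
    · linear_combination (f j * A j * z s) * koszulSign_mul_self (R := R) j s
    · exact Finset.sum_congr rfl fun l _ => by ring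
  have h₂ : koszulContract A (koszulWedge f z) s =
      ∑ l ∈ sᶜ, A l * f l * z s + ∑ l ∈ sᶜ, ∑ j ∈ s,
        koszulSign R l s * koszulSign R j (insert l s) *
          (f j * A l * z (insert l (s.erase j))) := by
    rw [← Finset.sum_add_distrib]
    refine Finset.sum_congr rfl fun l hl => ?_
    have hl' : l ∉ s := Finset.mem_compl.1 hl
    rw [koszulWedge, Finset.sum_insert hl', mul_add, Finset.erase_insert hl',
      koszulSign_insert_self hl', Finset.mul_sum]
    congr 1
    · linear_combination (f l * A l * z s) * koszulSign_mul_self (R := R) l s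
    · refine Finset.sum_congr rfl fun j hj => ?_
      rw [Finset.erase_insert_of_ne (ne_of_mem_of_not_mem hj hl').symm]
      ring
  have h₃ : ∑ j ∈ s, ∑ l ∈ sᶜ, (koszulSign R j s * koszulSign R l (s.erase j) *
        (f j * A l * z (insert l (s.erase j)))) + ∑ l ∈ sᶜ, ∑ j ∈ s,
      (koszulSign R l s * koszulSign R j (insert l s) *
        (f j * A l * z (insert l (s.erase j)))) = 0 := by
    rw [Finset.sum_comm (s := sᶜ), ← Finset.sum_add_distrib]
    refine Finset.sum_eq_zero fun j hj => ?_
    rw [← Finset.sum_add_distrib]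
    refine Finset.sum_eq_zero fun l hl => ?_
    rw [← add_mul, koszulSign_erase_add_insert hj (Finset.mem_compl.1 hl), zero_mul]
  rw [h₁, h₂, Finset.sum_mul, ← Finset.sum_add_sum_compl s]
  linear_combination h₃

theorem koszulWedge_add (f : ι → R) (y z : Finset ι → R) :
    koszulWedge f (y + z) = koszulWedge f y + koszulWedge f z := by
  ext s
  simp [koszulWedge, mul_add, Finset.sum_add_distrib]

theorem koszulWedge_smul (f : ι → R) (a : R) (z : Finset ι → R) :
    koszulWedge f (a • z) = a • koszulWedge f z := by
  ext s
  simp only [koszulWedge, Pi.smul_apply, smul_eq_mul, Finset.mul_sum]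
  exact Finset.sum_congr rfl fun j _ => by ring

theorem koszulWedge_mem {I : Ideal R} (f : ι → R) {z : Finset ι → R} (hz : ∀ s, z s ∈ I)
    (s : Finset ι) : koszulWedge f z s ∈ I :=
  I.sum_mem fun _ _ => I.mul_mem_left _ (hz _)

theorem koszulContract_mem [Fintype ι] {I : Ideal R} (A : ι → R) {z : Finset ι → R}
    (hz : ∀ s, z s ∈ I) (s : Finset ι) : koszulContract A z s ∈ I :=
  I.sum_mem fun _ _ => I.mul_mem_left _ (hz _)

/-- If `a = ∑ j, A j * f j` is a non-zero-divisor modulo `I`, then a Koszul cycle modulo `I` whose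
contraction by `A` is a boundary modulo `I + (a)` is itself a boundary modulo `I`. -/
theorem exists_sub_koszulWedge_mem [Fintype ι] {I : Ideal R} {f A : ι → R} {a : R}
    (ha : a = ∑ j, A j * f j) (hreg : ∀ p, a * p ∈ I → p ∈ I) {z : Finset ι → R}
    (hz : ∀ s, koszulWedge f z s ∈ I)
    (hC : ∃ y, ∀ s, koszulContract A z s - koszulWedge f y s ∈ I ⊔ Ideal.span {a}) :
    ∃ y, ∀ s, z s - koszulWedge f y s ∈ I := by
  obtain ⟨y, hy⟩ := hC
  have hex : ∀ s, ∃ r u, r ∈ I ∧ koszulContract A z s - koszulWedge f y s = r + a * u := by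
    intro s
    obtain ⟨r, hr, v, hv, h⟩ := Submodule.mem_sup.1 (hy s)
    obtain ⟨u, rfl⟩ := Ideal.mem_span_singleton.1 hv
    exact ⟨r, u, hr, h.symm⟩
  choose r u hr hu using hex
  refine ⟨u, fun s => hreg _ ?_⟩
  have hcz : koszulContract A z = koszulWedge f y + (r + a • u) := by
    ext s
    simp only [Pi.add_apply, Pi.smul_apply, smul_eq_mul]
    linear_combination hu s
  have hcar := koszulWedge_koszulContract_add f A z s
  rw [hcz, koszulWedge_add, koszulWedge_add, koszulWedge_smul, ← ha] at hcar
  simp only [Pi.add_apply, Pi.smul_apply, smul_eq_mul, koszulWedge_koszulWedge] at hcar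
  have : a * (z s - koszulWedge f u s) =
      koszulWedge f r s + koszulContract A (koszulWedge f z) s := by
    linear_combination -hcar
  rw [this]
  exact I.add_mem (koszulWedge_mem f hr s) (koszulContract_mem A hz s)

end Koszul

section WeightedHomogeneous

variable {R σ M : Type*} [CommRing R]

theorem weight_intCast (w : σ → ℕ) (m : σ →₀ ℕ) :
    Finsupp.weight (fun i => (w i : ℤ)) m = (Finsupp.weight w m : ℤ) := by
  simp [Finsupp.weight_apply, Finsupp.sum]

theorem isWeightedHomogeneous_intCast_iff {w : σ → ℕ} {p : MvPolynomial σ R} {k : ℕ} :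
    IsWeightedHomogeneous (fun i => (w i : ℤ)) p (k : ℤ) ↔ IsWeightedHomogeneous w p k := by
  simp only [IsWeightedHomogeneous, weight_intCast, Nat.cast_inj]

theorem weightedHomogeneousComponent_mul_of_left [AddCancelCommMonoid M] {w : σ → M}
    {p : MvPolynomial σ R} {i : M} (hp : IsWeightedHomogeneous w p i) (q : MvPolynomial σ R)
    (j : M) : weightedHomogeneousComponent w (i + j) (p * q) =
      p * weightedHomogeneousComponent w j q := by
  classical
  let := weightedGradedAlgebra R w
  have h := DirectSum.coe_decompose_mul_add_of_left_mem (weightedHomogeneousSubmodule R w)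
    (i := i) (j := j) (a := p) (b := q) hp
  simp only [← weightedDecomposition.decompose'_apply]
  exact h

/-- A weighted homogeneous combination of weighted homogeneous polynomials is such a combination
with weighted homogeneous coefficients. -/
theorem exists_isWeightedHomogeneous_sum_mul {ι : Type*} [Fintype ι] [AddCommGroup M]
    {w : σ → M} {f : ι → MvPolynomial σ R} {e : ι → M}
    (hf : ∀ j, IsWeightedHomogeneous w (f j) (e j)) {p : MvPolynomial σ R} {k : M}
    (hp : IsWeightedHomogeneous w p k) (hmem : p ∈ Ideal.span (Set.range f)) :
    ∃ h : ι → MvPolynomial σ R,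
      (∀ j, IsWeightedHomogeneous w (h j) (k - e j)) ∧ p = ∑ j, h j * f j := by
  obtain ⟨b, rfl⟩ := (Ideal.mem_span_range_iff_exists_fun).1 hmem
  refine ⟨fun j => weightedHomogeneousComponent w (k - e j) (b j),
    fun j => weightedHomogeneousComponent_isWeightedHomogeneous _ _, ?_⟩
  conv_lhs => rw [← hp.weightedHomogeneousComponent_same, map_sum]
  refine Finset.sum_congr rfl fun j _ => ?_
  rw [mul_comm, mul_comm _ (f j), ← weightedHomogeneousComponent_mul_of_left (hf j),
    add_sub_cancel]

/-- Modulo an ideal with Artinian quotient that is homogeneous for positive weights, every variable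
is nilpotent. -/
theorem exists_X_pow_mem_of_isArtinianRing {w : σ → ℕ} (hw : ∀ i, w i ≠ 0)
    {S : Set (MvPolynomial σ R)} (hS : ∀ p ∈ S, ∃ m, IsWeightedHomogeneous w p m)
    [IsArtinianRing (MvPolynomial σ R ⧸ Ideal.span S)] (i : σ) :
    ∃ N, X i ^ N ∈ Ideal.span S := by
  let := weightedGradedAlgebra R w
  have hJ := Ideal.homogeneous_span (weightedHomogeneousSubmodule R w) S hS
  obtain ⟨N, y, hy⟩ := IsArtinian.exists_pow_succ_smul_dvd
    (Ideal.Quotient.mk (Ideal.span S) (X i)) (1 : MvPolynomial σ R ⧸ Ideal.span S)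
  obtain ⟨b, rfl⟩ := Ideal.Quotient.mk_surjective y
  have hmem : X i ^ N * (1 - X i * b) ∈ Ideal.span S := by
    rw [← Ideal.Quotient.eq_zero_iff_mem]
    simp only [smul_eq_mul, mul_one, pow_succ] at hy
    simp only [map_mul, map_sub, map_pow, map_one]
    linear_combination -hy
  have h := weightedHomogeneousComponent_mem_of_mem R w hJ hmem (N • w i + 0)
  rw [weightedHomogeneousComponent_mul_of_left ((isWeightedHomogeneous_X R w i).pow N),
    weightedHomogeneousComponent_zero _ hw] at h
  exact ⟨N, by simpa [← constantCoeff_eq] using h⟩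

theorem mem_span_X_pow_image_iff {N : σ → ℕ} {s : Set σ} {p : MvPolynomial σ R} :
    p ∈ Ideal.span ((fun l => (X l : MvPolynomial σ R) ^ N l) '' s) ↔
      ∀ m ∈ p.support, ∃ l ∈ s, N l ≤ m l := by
  have h : (fun l => (X l : MvPolynomial σ R) ^ N l) '' s =
      (fun m => monomial m (1 : R)) '' ((fun l => Finsupp.single l (N l)) '' s) := by
    simp only [Set.image_image, X_pow_eq_monomial]
  simp [h, mem_ideal_span_monomial_image]

theorem mem_span_X_pow_image_of_X_pow_mul_mem {N : σ → ℕ} {s : Set σ} {i : σ} (hi : i ∉ s)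
    {p : MvPolynomial σ R}
    (h : X i ^ N i * p ∈ Ideal.span ((fun l => (X l : MvPolynomial σ R) ^ N l) '' s)) :
    p ∈ Ideal.span ((fun l => (X l : MvPolynomial σ R) ^ N l) '' s) := by
  rw [mem_span_X_pow_image_iff] at h ⊢
  intro m hm
  obtain ⟨l, hl, hlm⟩ := h (Finsupp.single i (N i) + m) (by
    rw [mem_support_iff, X_pow_eq_monomial, coeff_monomial_mul, one_mul]
    exact mem_support_iff.1 hm)
  refine ⟨l, hl, ?_⟩
  rwa [Finsupp.add_apply, Finsupp.single_eq_of_ne (ne_of_mem_of_not_mem hl hi), zero_add] at hlm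

/-- A weighted homogeneous polynomial of degree larger than `∑ (N l - 1) * w l` lies in the ideal
generated by the powers `X l ^ N l`. -/
theorem mem_span_X_pow_of_lt [Fintype σ] {w N : σ → ℕ} {p : MvPolynomial σ R} {k : ℤ}
    (hp : IsWeightedHomogeneous (fun i => (w i : ℤ)) p k)
    (hk : ∑ l, ((N l : ℤ) - 1) * w l < k) :
    p ∈ Ideal.span ((fun l => (X l : MvPolynomial σ R) ^ N l) '' Set.univ) := by
  rw [mem_span_X_pow_image_iff]
  intro m hm
  by_contra! h
  have hwt := hp (mem_support_iff.1 hm)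
  rw [Finsupp.weight_apply, Finsupp.sum_fintype _ _ (by simp)] at hwt
  have : ∑ l, m l • (w l : ℤ) ≤ ∑ l, ((N l : ℤ) - 1) * w l := by
    refine Finset.sum_le_sum fun l _ => ?_
    rw [nsmul_eq_mul]
    have := h l (Set.mem_univ l)
    exact mul_le_mul_of_nonneg_right (by omega) (by positivity)
  exact absurd hwt (this.trans_lt hk).ne

/-- Contraction by weighted homogeneous `A j` of degree `D - e j`. -/
theorem isWeightedHomogeneous_koszulContract {n : ℕ} [AddCommGroup M] {w : σ → M}
    {e : Fin n → M} {D k : M} {A : Fin n → MvPolynomial σ R}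
    (hA : ∀ j, IsWeightedHomogeneous w (A j) (D - e j))
    {z : Finset (Fin n) → MvPolynomial σ R}
    (hz : ∀ s, IsWeightedHomogeneous w (z s) (k - ∑ j ∈ sᶜ, e j)) (s : Finset (Fin n)) :
    IsWeightedHomogeneous w (koszulContract A z s) (k + D - ∑ j ∈ sᶜ, e j) := by
  refine IsWeightedHomogeneous.sum _ _ _ fun j hj => ?_
  have hsign : IsWeightedHomogeneous w (koszulSign (MvPolynomial σ R) j s) 0 := by
    have := IsWeightedHomogeneous.prod (w := w) (R := R) s
      (fun i => if i < j then -1 else 1) (fun _ => 0) fun i _ => by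
        split_ifs
        · exact (isWeightedHomogeneous_one R w).neg
        · exact isWeightedHomogeneous_one R w
    rwa [Finset.sum_const_zero] at this
  convert (hsign.mul (hA j)).mul (hz (insert j s)) using 1
  rw [Finset.compl_insert, ← Finset.add_sum_erase _ _ hj]
  abel

end WeightedHomogeneous

section MacaulayBound

variable {R : Type*} [CommRing R] {n : ℕ} {w : Fin n → ℕ} {f : Fin n → MvPolynomial (Fin n) R}
  {e : Fin n → ℤ} {N : Fin n → ℕ} {A : Fin n → Fin n → MvPolynomial (Fin n) R}

/-- The induction removes the powers `X i ^ N i`, `i ∈ U`, one at a time; a Koszul cycle of high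
degree modulo the remaining powers is a boundary modulo them. -/
theorem exists_sub_koszulWedge_mem_span_X_pow
    (hA : ∀ i j, IsWeightedHomogeneous (fun l => (w l : ℤ)) (A i j) (N i * w i - e j))
    (hN : ∀ i, X i ^ N i = ∑ j, A i j * f j) (U : Finset (Fin n)) (k : ℤ)
    (hk : ∑ j, e j + ∑ l ∈ Uᶜ, (N l : ℤ) * w l - ∑ l, (w l : ℤ) < k)
    (z : Finset (Fin n) → MvPolynomial (Fin n) R)
    (hz : ∀ s, IsWeightedHomogeneous (fun l => (w l : ℤ)) (z s) (k - ∑ j ∈ sᶜ, e j))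
    (hcard : ∀ s, s.card ≠ U.card → z s = 0)
    (hcycle : ∀ s, koszulWedge f z s ∈
      Ideal.span ((fun l => (X l : MvPolynomial (Fin n) R) ^ N l) '' (U : Set (Fin n))ᶜ)) :
    ∃ y, ∀ s, z s - koszulWedge f y s ∈
      Ideal.span ((fun l => (X l : MvPolynomial (Fin n) R) ^ N l) '' (U : Set (Fin n))ᶜ) := by
  induction U using Finset.induction_on generalizing k z with
  | empty =>
    refine ⟨0, fun s => ?_⟩
    have h0 : koszulWedge f 0 s = 0 := by simp [koszulWedge]
    rw [h0, sub_zero, Finset.coe_empty, Set.compl_empty]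
    rcases s.eq_empty_or_nonempty with rfl | hs
    · refine mem_span_X_pow_of_lt (hz ∅) ?_
      simp only [Finset.compl_empty] at hk ⊢
      simp only [sub_mul, one_mul, Finset.sum_sub_distrib]
      linarith
    · rw [hcard s (by simpa using hs.ne_empty)]
      exact Ideal.zero_mem _
  | insert i U hi ih =>
    have hI : Ideal.span ((fun l => (X l : MvPolynomial (Fin n) R) ^ N l) ''
          (U : Set (Fin n))ᶜ) =
        Ideal.span ((fun l => (X l : MvPolynomial (Fin n) R) ^ N l) ''
          ((insert i U : Finset (Fin n)) : Set (Fin n))ᶜ) ⊔ Ideal.span {X i ^ N i} := by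
      have hset : (U : Set (Fin n))ᶜ = ((insert i U : Finset (Fin n)) : Set (Fin n))ᶜ ∪ {i} := by
        ext l
        by_cases hl : l = i <;> simp [hl, hi]
      rw [hset, Set.image_union, Ideal.span_union, Set.image_singleton]
    refine exists_sub_koszulWedge_mem (hN i)
      (fun p => mem_span_X_pow_image_of_X_pow_mul_mem (N := N) (by simp)) hcycle ?_
    rw [← hI]
    refine ih (k + N i * w i) ?_ _ (fun s => isWeightedHomogeneous_koszulContract (hA i) hz s)
      (fun s hs => ?_) (fun s => ?_)
    · rw [Finset.compl_insert] at hk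
      rw [← Finset.add_sum_erase Uᶜ _ (Finset.mem_compl.2 hi)]
      linarith
    · refine Finset.sum_eq_zero fun j hj => ?_
      rw [hcard _, mul_zero]
      rwa [Finset.card_insert_of_notMem (Finset.mem_compl.1 hj),
        Finset.card_insert_of_notMem hi, Ne, Nat.add_right_cancel_iff]
    · have h := koszulWedge_koszulContract_add f (A i) z s
      rw [← hN i] at h
      rw [eq_sub_of_add_eq h, hI]
      exact Ideal.sub_mem _
        (Ideal.mem_sup_right (Ideal.mul_mem_right _ _ (Ideal.mem_span_singleton_self _)))
        (Ideal.mem_sup_left (koszulContract_mem _ hcycle s))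

/-- **Macaulay's bound**: if `n` weighted homogeneous polynomials `f j` of degrees `e j` in `n`
variables generate an ideal containing a power of each variable, then it contains every weighted
homogeneous polynomial of degree larger than `∑ e j - ∑ w j`. -/
theorem mem_span_range_of_lt
    (hf : ∀ j, IsWeightedHomogeneous (fun l => (w l : ℤ)) (f j) (e j))
    (hN : ∀ i, X i ^ N i ∈ Ideal.span (Set.range f)) {g : MvPolynomial (Fin n) R} {k : ℤ}
    (hg : IsWeightedHomogeneous (fun l => (w l : ℤ)) g k)
    (hk : ∑ j, e j - ∑ l, (w l : ℤ) < k) : g ∈ Ideal.span (Set.range f) := by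
  have hX : ∀ i, IsWeightedHomogeneous (fun l => (w l : ℤ))
      ((X i : MvPolynomial (Fin n) R) ^ N i) (N i * w i) := fun i => by
    simpa using (isWeightedHomogeneous_X R (fun l => (w l : ℤ)) i).pow (N i)
  choose A hA hNA using fun i => exists_isWeightedHomogeneous_sum_mul hf (hX i) (hN i)
  have hz : ∀ s, IsWeightedHomogeneous (fun l => (w l : ℤ))
      ((Pi.single Finset.univ g : Finset (Fin n) → MvPolynomial (Fin n) R) s)
      (k - ∑ j ∈ sᶜ, e j) := fun s => by
    rcases eq_or_ne s Finset.univ with rfl | hs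
    · simpa using hg
    · rw [Pi.single_eq_of_ne hs]
      exact isWeightedHomogeneous_zero R _ _
  obtain ⟨y, hy⟩ := exists_sub_koszulWedge_mem_span_X_pow hA hNA Finset.univ k (by simpa using hk)
    (Pi.single Finset.univ g) hz (fun s hs => Pi.single_eq_of_ne (ne_of_apply_ne Finset.card hs) _)
    fun s => Ideal.sum_mem _ fun j _ => by
      rw [Pi.single_eq_of_ne fun h : s.erase j = Finset.univ =>
        Finset.notMem_erase j s (h ▸ Finset.mem_univ j), mul_zero]
      exact Ideal.zero_mem _
  have h := hy Finset.univ
  simp only [Finset.coe_univ, Set.compl_univ, Set.image_empty, Ideal.span_empty,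
    Ideal.mem_bot, Pi.single_eq_same] at h
  rw [sub_eq_zero.1 h]
  exact Ideal.sum_mem _ fun j _ => Ideal.mul_mem_right _ _
    (Ideal.mul_mem_left _ _ (Ideal.subset_span ⟨j, rfl⟩))

end MacaulayBound

/-- For a weighted homogeneous polynomial `f` of degree `d` (weights `w i`,
`2 w i ≤ d`) with an isolated singularity at `0`, for every `k > n·d − 2·Σᵢ wᵢ` every
weighted homogeneous `g` of degree `k` can be written as `g = Σᵢ fᵢ hᵢ` with `hᵢ` weighted
homogeneous of degree `k − (d − wᵢ)`; in particular `Q_k = 0` for such `k`. -/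
theorem stmt4 (n : ℕ) (hn : 1 ≤ n) (d : ℕ) (w : Fin n → ℕ)
    (hd : 0 < d) (hw : ∀ i, 0 < w i) (hwd : ∀ i, 2 * w i ≤ d)
    (f : MvPolynomial (Fin n) ℂ)
    (hf : MvPolynomial.IsWeightedHomogeneous w f d)
    (hiso : FiniteDimensional ℂ (MvPolynomial (Fin n) ℂ ⧸ jacobianIdeal n f)) :
    ∀ k : ℕ, n * d - 2 * ∑ i, w i < k →
      (∀ g : MvPolynomial (Fin n) ℂ, MvPolynomial.IsWeightedHomogeneous w g k →
        ∃ h : Fin n → MvPolynomial (Fin n) ℂ,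
          (∀ i, MvPolynomial.IsWeightedHomogeneous w (h i) (k - (d - w i))) ∧
          g = ∑ i : Fin n, pderiv i f * h i) ∧
      milnorPiece n w f k = ⊥ := by
  intro k hk
  have hpd : ∀ i, IsWeightedHomogeneous w (pderiv i f) (d - w i) := fun i =>
    hf.pderiv (Nat.sub_add_cancel (by have := hwd i; omega))
  have hpd' : ∀ i, IsWeightedHomogeneous (fun l => (w l : ℤ)) (pderiv i f)
      ((d - w i : ℕ) : ℤ) := fun i => isWeightedHomogeneous_intCast_iff.2 (hpd i)
  have hpow : ∀ i, ∃ N, X i ^ N ∈ jacobianIdeal n f := by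
    have : IsArtinianRing (MvPolynomial (Fin n) ℂ ⧸
        Ideal.span (Set.range fun i => pderiv i f)) :=
      have : FiniteDimensional ℂ (MvPolynomial (Fin n) ℂ ⧸
        Ideal.span (Set.range fun i => pderiv i f)) := hiso
      IsArtinianRing.of_finite ℂ _
    refine exists_X_pow_mem_of_isArtinianRing (fun i => (hw i).ne') ?_
    rintro _ ⟨i, rfl⟩
    exact ⟨_, hpd i⟩
  choose N hN using hpow
  have hdeg : ∑ j, ((d - w j : ℕ) : ℤ) - ∑ l, (w l : ℤ) < k := by
    have h₁ : ∀ j, ((d - w j : ℕ) : ℤ) = d - w j := fun j =>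
      Nat.cast_sub (by have := hwd j; omega)
    simp only [h₁, Finset.sum_sub_distrib, Finset.sum_const, Finset.card_univ, Fintype.card_fin,
      nsmul_eq_mul]
    have h₂ : (n * d : ℤ) < k + 2 * ∑ l, (w l : ℤ) := by
      exact_mod_cast (by omega : n * d < k + 2 * ∑ l, w l)
    linarith
  have hmem : ∀ g, IsWeightedHomogeneous w g k → g ∈ jacobianIdeal n f := fun g hg =>
    mem_span_range_of_lt hpd' hN (isWeightedHomogeneous_intCast_iff.2 hg) hdeg
  refine ⟨fun g hg => ?_, ?_⟩
  · obtain ⟨h, hh, hsum⟩ := exists_isWeightedHomogeneous_sum_mul hpd'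
      (isWeightedHomogeneous_intCast_iff.2 hg) (hmem g hg)
    refine ⟨h, fun i m hm => ?_, by simpa only [mul_comm] using hsum⟩
    have h₁ := hh i hm
    rw [weight_intCast] at h₁
    omega
  · rw [milnorPiece, eq_bot_iff]
    rintro _ ⟨g, hg, rfl⟩
    simpa [Ideal.Quotient.eq_zero_iff_mem] using hmem g hg
end

section
/- With the weighted-homogeneous isolated-singularity setup, the top graded piece of the Milnor algebra is one-dimensional: dim_ℂ Q_{n·d − 2·Σᵢdᵢ} = 1. In particular, there exists a weighted homogeneous polynomial of degree n·d − 2·Σᵢdᵢ which does not lie in the Jacobian ideal J. -/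
open MvPolynomial

/-- Prime avoidance for a coset `y + I`: if no prime of the finite set `S` contains both `y` and
`I`, then some element of `y + I` avoids all primes of `S`. -/
theorem Ideal.exists_add_notMem_of_finset_prime {R : Type*} [CommRing R] (I : Ideal R) (y : R)
    (S : Finset (Ideal R)) (hS : ∀ P ∈ S, P.IsPrime) (h : ∀ P ∈ S, ¬ (y ∈ P ∧ I ≤ P)) :
    ∃ c ∈ I, ∀ P ∈ S, y + c ∉ P := by
  classical
  induction S using Finset.strongInduction with
  | H S ih =>
    rcases S.eq_empty_or_nonempty with rfl | hne
    · exact ⟨0, I.zero_mem, by simp⟩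
    obtain ⟨P, hPS, hmin⟩ := S.exists_minimal hne
    obtain ⟨c, hc, hcS⟩ := ih (S.erase P) (Finset.erase_ssubset hPS)
      (fun Q hQ => hS Q (Finset.mem_of_mem_erase hQ))
      (fun Q hQ => h Q (Finset.mem_of_mem_erase hQ))
    by_cases hyc : y + c ∈ P
    swap
    · refine ⟨c, hc, fun Q hQ => ?_⟩
      by_cases hQP : Q = P
      · exact hQP ▸ hyc
      · exact hcS Q (Finset.mem_erase.2 ⟨hQP, hQ⟩)
    have hPp := hS P hPS
    have hIP : ¬ I ≤ P := fun hIP =>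
      h P hPS ⟨(P.add_mem_iff_left (hIP hc)).1 hyc, hIP⟩
    have hprod : ¬ I * ∏ Q ∈ S.erase P, Q ≤ P := by
      intro hle
      rcases hPp.mul_le.1 hle with hle | hle
      · exact hIP hle
      · obtain ⟨Q, hQ, hQP⟩ := (hPp.prod_le).1 hle
        have hQS := Finset.mem_of_mem_erase hQ
        exact Finset.ne_of_mem_erase hQ (le_antisymm hQP (hmin hQS hQP))
    obtain ⟨c', hc', hc'P⟩ := Set.not_subset.1 hprod
    obtain ⟨hc'I, hc'prod⟩ := Ideal.mul_le_inf hc'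
    refine ⟨c + c', I.add_mem hc hc'I, fun Q hQ => ?_⟩
    rw [← add_assoc]
    by_cases hQP : Q = P
    · subst hQP
      exact fun hmem => hc'P ((Q.add_mem_iff_right hyc).1 hmem)
    · have hQ' : Q ∈ S.erase P := Finset.mem_erase.2 ⟨hQP, hQ⟩
      have : c' ∈ Q := (Ideal.prod_le_inf.trans (Finset.inf_le hQ')) hc'prod
      exact fun hmem => hcS Q hQ' ((Q.add_mem_iff_left this).1 hmem)

open IsLocalRing RingTheory.Sequence in
/-- Over a Noetherian local ring, if a finite module `M` admits a weakly regular sequence of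
length `r` in the maximal ideal, then every sequence of length `r` in the maximal ideal that
generates an ideal primary to the maximal ideal modulo `Ann M` is weakly regular on `M`. -/
theorem IsLocalRing.isWeaklyRegular_of_maximalIdeal_le_radical {R : Type*} [CommRing R]
    [IsLocalRing R] [IsNoetherianRing R] (ys : List R) :
    ∀ (xs : List R) (M : Type*) [AddCommGroup M] [Module R M] [Module.Finite R M],
      xs.length = ys.length → (∀ x ∈ xs, x ∈ maximalIdeal R) → (∀ y ∈ ys, y ∈ maximalIdeal R) →
      IsWeaklyRegular M xs →
      maximalIdeal R ≤ (Ideal.ofList ys ⊔ Module.annihilator R M).radical →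
      IsWeaklyRegular M ys := by
  induction ys with
  | nil => intro _ M _ _ _ _ _ _ _ _; exact .nil R M
  | cons y ys ih =>
    intro xs M _ _ _ hlen hxs hys hreg hrad
    match xs, hlen with
    | x :: xs, hlen =>
    have hperm : IsWeaklyRegular M (xs ++ [x]) :=
      isWeaklyRegular_of_perm_of_subset_maximalIdeal hreg (List.perm_append_singleton x xs).symm hxs
    rw [isWeaklyRegular_append_iff, isWeaklyRegular_singleton_iff] at hperm
    obtain ⟨hxs_reg, hx_reg⟩ := hperm
    set N := M ⧸ (Ideal.ofList xs • ⊤ : Submodule R M)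
    have hfin := associatedPrimes.finite R N
    obtain ⟨c, hc, hcN⟩ := (Ideal.ofList ys).exists_add_notMem_of_finset_prime y hfin.toFinset
      (fun P hP => (hfin.mem_toFinset.1 hP).isPrime) (by
        rintro P hP ⟨hyP, hysP⟩
        have hP := hfin.mem_toFinset.1 hP
        have hann : Module.annihilator R M ≤ P :=
          (LinearMap.annihilator_le_of_surjective _ (Submodule.mkQ_surjective _)).trans
            (Submodule.annihilator_top.symm.trans_le hP.annihilator_le)
        have hle : Ideal.ofList (y :: ys) ⊔ Module.annihilator R M ≤ P := by
          rw [Ideal.ofList_cons]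
          exact sup_le (sup_le ((Ideal.span_singleton_le_iff_mem P).2 hyP) hysP) hann
        have hxP : x ∈ P := (hP.isPrime.radical_le_iff.2 hle) (hrad (hxs x (by simp)))
        have : x ∈ ⋃ Q ∈ associatedPrimes R N, (Q : Set R) := Set.mem_biUnion hP hxP
        rw [biUnion_associatedPrimes_eq_compl_regular] at this
        exact this hx_reg)
    have hz_regN : IsSMulRegular N (y + c) := by
      by_contra hcon
      have : y + c ∈ ⋃ Q ∈ associatedPrimes R N, (Q : Set R) := by
        rw [biUnion_associatedPrimes_eq_compl_regular]
        exact hcon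
      obtain ⟨Q, hQ, hmem⟩ := Set.mem_iUnion₂.1 this
      exact hcN Q (hfin.mem_toFinset.2 hQ) hmem
    have hcm : c ∈ maximalIdeal R :=
      (Ideal.span_le.2 fun a ha => hys a (List.mem_cons_of_mem _ ha)) hc
    have hzm : y + c ∈ maximalIdeal R := add_mem (hys y (by simp)) hcm
    have hmem_cons : ∀ (a : R) (l : List R), a ∈ maximalIdeal R → (∀ r ∈ l, r ∈ maximalIdeal R) →
        ∀ r ∈ l ++ [a], r ∈ maximalIdeal R := by
      intro a l ha hl r hr
      rcases List.mem_append.1 hr with hr | hr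
      · exact hl r hr
      · exact (List.mem_singleton.1 hr) ▸ ha
    have hxsm : ∀ r ∈ xs, r ∈ maximalIdeal R := fun r hr => hxs r (List.mem_cons_of_mem _ hr)
    have hysm : ∀ r ∈ ys, r ∈ maximalIdeal R := fun r hr => hys r (List.mem_cons_of_mem _ hr)
    have hz_xs : IsWeaklyRegular M ((y + c) :: xs) :=
      isWeaklyRegular_of_perm_of_subset_maximalIdeal
        ((isWeaklyRegular_append_iff _ _ _).2 ⟨hxs_reg, (isWeaklyRegular_singleton_iff _ _).2 hz_regN⟩)
        (List.perm_append_singleton _ _) (hmem_cons _ _ hzm hxsm)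
    rw [isWeaklyRegular_cons_iff] at hz_xs
    have hys_reg : IsWeaklyRegular (QuotSMulTop (y + c) M) ys := by
      refine ih xs _ (by simpa using hlen) hxsm hysm hz_xs.2
        (hrad.trans (Ideal.radical_mono ?_))
      have hz_ann : y + c ∈ Module.annihilator R (QuotSMulTop (y + c) M) := by
        rw [Module.mem_annihilator]
        intro q
        obtain ⟨m, rfl⟩ := Submodule.mkQ_surjective _ q
        rw [← map_smul]
        exact (Submodule.Quotient.mk_eq_zero _).2
          (Submodule.smul_mem_pointwise_smul m (y + c) ⊤ trivial)
      rw [Ideal.ofList_cons]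
      refine sup_le (sup_le ?_ le_sup_left) (le_sup_of_le_right
        (LinearMap.annihilator_le_of_surjective _ (Submodule.mkQ_surjective _)))
      rw [Ideal.span_singleton_le_iff_mem]
      simpa using sub_mem (Ideal.mem_sup_right (S := Ideal.ofList ys) hz_ann)
        (Ideal.mem_sup_left hc)
    have hys_z : IsWeaklyRegular M (ys ++ [y + c]) :=
      isWeaklyRegular_of_perm_of_subset_maximalIdeal
        ((isWeaklyRegular_cons_iff _ _ _).2 ⟨hz_xs.1, hys_reg⟩)
        (List.perm_append_singleton _ _).symm
        (by
          intro r hr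
          rcases List.mem_cons.1 hr with rfl | hr
          exacts [hzm, hysm r hr])
    rw [isWeaklyRegular_append_iff, isWeaklyRegular_singleton_iff,
      isSMulRegular_quotient_iff_mem_of_smul_mem] at hys_z
    refine isWeaklyRegular_of_perm_of_subset_maximalIdeal
      ((isWeaklyRegular_append_iff _ _ _).2 ⟨hys_z.1, (isWeaklyRegular_singleton_iff _ _).2 ?_⟩)
      (List.perm_append_singleton y ys) (hmem_cons _ _ (hys y (by simp)) hysm)
    rw [isSMulRegular_quotient_iff_mem_of_smul_mem]
    intro m hm
    refine hys_z.2 m ?_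
    rw [add_smul]
    exact add_mem hm (Submodule.smul_mem_smul hc trivial)

section HilbertSeries

attribute [local instance] MvPolynomial.weightedGradedAlgebra

variable {K σ : Type*} [Field K]

theorem MvPolynomial.weightedHomogeneousComponent_mul_of_isWeightedHomogeneous {w : σ → ℕ}
    {g : MvPolynomial σ K} {e : ℕ} (hg : IsWeightedHomogeneous w g e) (h : MvPolynomial σ K)
    (k : ℕ) :
    weightedHomogeneousComponent w k (g * h) =
      if e ≤ k then g * weightedHomogeneousComponent w (k - e) h else 0 := by
  have := DirectSum.coe_decompose_mul_of_left_mem (weightedHomogeneousSubmodule K w) (b := h) k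
    ((mem_weightedHomogeneousSubmodule K w e g).2 hg)
  simp only [← weightedDecomposition.decompose'_apply]
  exact this

theorem MvPolynomial.weightedHomogeneousComponent_mem_span {w : σ → ℕ}
    {s : Set (MvPolynomial σ K)} (hs : ∀ g ∈ s, ∃ e, IsWeightedHomogeneous w g e)
    {p : MvPolynomial σ K} (hp : p ∈ Ideal.span s) (k : ℕ) :
    weightedHomogeneousComponent w k p ∈ Ideal.span s :=
  weightedHomogeneousComponent_mem_of_mem K w (Ideal.homogeneous_span _ s hs) hp k

/-- The degree-`k` graded piece of `K[x] ⧸ I` for the weights `w`. -/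
noncomputable def weightedQuotientPiece (w : σ → ℕ) (I : Ideal (MvPolynomial σ K)) (k : ℕ) :
    Submodule K (MvPolynomial σ K ⧸ I) :=
  (weightedHomogeneousSubmodule K w k).map (Ideal.Quotient.mkₐ K I).toLinearMap

/-- The Hilbert series of `K[x] ⧸ I` for the weights `w`. -/
noncomputable def weightedHilbertSeries (w : σ → ℕ) (I : Ideal (MvPolynomial σ K)) :
    PowerSeries ℤ :=
  PowerSeries.mk fun k => (Module.finrank K (weightedQuotientPiece w I k) : ℤ)

theorem finiteDimensional_weightedQuotientPiece [Finite σ] {w : σ → ℕ} (hw : ∀ i, w i ≠ 0)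
    (I : Ideal (MvPolynomial σ K)) (k : ℕ) :
    FiniteDimensional K (weightedQuotientPiece w I k) :=
  Module.Finite.iff_fg.2 ((weightedHomogeneousSubmodule_fg K w hw k).map _)

theorem mk_mem_weightedQuotientPiece {w : σ → ℕ} (I : Ideal (MvPolynomial σ K)) {k : ℕ}
    {p : MvPolynomial σ K} (hp : IsWeightedHomogeneous w p k) :
    Ideal.Quotient.mk I p ∈ weightedQuotientPiece w I k :=
  ⟨p, hp, rfl⟩

theorem map_factor_weightedQuotientPiece (w : σ → ℕ) {I J : Ideal (MvPolynomial σ K)}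
    (hIJ : I ≤ J) (k : ℕ) :
    (weightedQuotientPiece w I k).map (Ideal.Quotient.factorₐ K hIJ).toLinearMap =
      weightedQuotientPiece w J k := by
  rw [weightedQuotientPiece, ← Submodule.map_comp]
  rfl

theorem Submodule.finrank_map_add_finrank_inf_ker {V W : Type*} [AddCommGroup V] [Module K V]
    [AddCommGroup W] [Module K W] (P : Submodule K V) [FiniteDimensional K P] (φ : V →ₗ[K] W) :
    Module.finrank K (P.map φ) + Module.finrank K (P ⊓ LinearMap.ker φ : Submodule K V) =
      Module.finrank K P := by
  have h := LinearMap.finrank_range_add_finrank_ker (φ.domRestrict P)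
  rw [LinearMap.range_domRestrict, LinearMap.ker_domRestrict,
    ← Submodule.finrank_map_subtype_eq, Submodule.map_comap_subtype] at h
  exact h

/-- If the homogeneous element `g` of degree `e` is a non-zero-divisor modulo the homogeneous
ideal `I`, then passing to `I + (g)` multiplies the Hilbert series by `1 - X ^ e`. -/
theorem weightedHilbertSeries_sup_span_singleton [Finite σ] {w : σ → ℕ} (hw : ∀ i, w i ≠ 0)
    {I : Ideal (MvPolynomial σ K)}
    (hI : ∀ p ∈ I, ∀ k, weightedHomogeneousComponent w k p ∈ I)
    {g : MvPolynomial σ K} {e : ℕ} (hg : IsWeightedHomogeneous w g e)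
    (hreg : ∀ k h, IsWeightedHomogeneous w h k → g * h ∈ I → h ∈ I) :
    weightedHilbertSeries w (I ⊔ Ideal.span {g}) =
      (1 - PowerSeries.X ^ e) * weightedHilbertSeries w I := by
  ext k
  have := finiteDimensional_weightedQuotientPiece hw I
  set φ := (Ideal.Quotient.factorₐ K (le_sup_left : I ≤ I ⊔ Ideal.span {g})).toLinearMap
  have hdim := (weightedQuotientPiece w I k).finrank_map_add_finrank_inf_ker φ
  rw [map_factor_weightedQuotientPiece] at hdim
  have hker : ∀ p, IsWeightedHomogeneous w p k → φ (Ideal.Quotient.mk I p) = 0 →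
      ∃ h, p - (if e ≤ k then g * weightedHomogeneousComponent w (k - e) h else 0) ∈ I := by
    intro p hp h0
    have hmem : p ∈ I ⊔ Ideal.span {g} := Ideal.Quotient.eq_zero_iff_mem.1 h0
    obtain ⟨i, hi, q, hq, rfl⟩ := Submodule.mem_sup.1 hmem
    obtain ⟨h, rfl⟩ := Ideal.mem_span_singleton'.1 hq
    refine ⟨h, ?_⟩
    have h1 := hp.weightedHomogeneousComponent_same
    rw [map_add, mul_comm h g,
      weightedHomogeneousComponent_mul_of_isWeightedHomogeneous hg] at h1
    rw [mul_comm h g, ← h1, add_sub_cancel_right]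
    exact hI i hi k
  simp only [weightedHilbertSeries, sub_mul, one_mul, map_sub, PowerSeries.coeff_X_pow_mul',
    PowerSeries.coeff_mk]
  split_ifs with hek
  · have hinf : weightedQuotientPiece w I k ⊓ LinearMap.ker φ =
        (weightedQuotientPiece w I (k - e)).map
          (LinearMap.mulLeft K (Ideal.Quotient.mk I g)) := by
      ext x
      constructor
      · rintro ⟨⟨p, hp, rfl⟩, hx⟩
        obtain ⟨h, hh⟩ := hker p hp hx
        rw [if_pos hek] at hh
        refine ⟨_, mk_mem_weightedQuotientPiece I
          (weightedHomogeneousComponent_isWeightedHomogeneous (k - e) h), ?_⟩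
        rw [LinearMap.mulLeft_apply, ← map_mul]
        exact ((Ideal.Quotient.mk_eq_mk_iff_sub_mem _ _).2 hh).symm
      · rintro ⟨_, ⟨h, hh, rfl⟩, rfl⟩
        have hgh : IsWeightedHomogeneous w (g * h) k := by
          have := hg.mul hh
          rwa [Nat.add_sub_cancel' hek] at this
        refine ⟨mk_mem_weightedQuotientPiece I hgh, ?_⟩
        exact Ideal.Quotient.eq_zero_iff_mem.2 (Ideal.mem_sup_right
          (Ideal.mul_mem_right _ _ (Ideal.mem_span_singleton_self g)))
    have hzero : weightedQuotientPiece w I (k - e) ⊓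
        LinearMap.ker (LinearMap.mulLeft K (Ideal.Quotient.mk I g)) = ⊥ := by
      rw [eq_bot_iff]
      rintro _ ⟨⟨h, hh, rfl⟩, hx⟩
      exact Ideal.Quotient.eq_zero_iff_mem.2
        (hreg _ h hh (Ideal.Quotient.eq_zero_iff_mem.1 ((map_mul _ g h).trans hx)))
    have hdim' := (weightedQuotientPiece w I (k - e)).finrank_map_add_finrank_inf_ker
      (LinearMap.mulLeft K (Ideal.Quotient.mk I g))
    rw [hzero, finrank_bot, add_zero] at hdim'
    rw [hinf, hdim'] at hdim
    omega
  · have hinf : weightedQuotientPiece w I k ⊓ LinearMap.ker φ = ⊥ := by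
      rw [eq_bot_iff]
      rintro _ ⟨⟨p, hp, rfl⟩, hx⟩
      obtain ⟨h, hh⟩ := hker p hp hx
      rw [if_neg hek, sub_zero] at hh
      exact Ideal.Quotient.eq_zero_iff_mem.2 hh
    rw [hinf, finrank_bot] at hdim
    omega

instance isPrime_ker_constantCoeff :
    (RingHom.ker (constantCoeff : MvPolynomial σ K →+* K)).IsPrime :=
  RingHom.ker_isPrime _

theorem weightedHilbertSeries_ker_constantCoeff (w : σ → ℕ) :
    weightedHilbertSeries w (RingHom.ker (constantCoeff : MvPolynomial σ K →+* K)) = 1 := by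
  set m := RingHom.ker (constantCoeff : MvPolynomial σ K →+* K)
  ext k
  rw [weightedHilbertSeries, PowerSeries.coeff_mk, PowerSeries.coeff_one]
  split_ifs with hk
  · subst hk
    have hspan : weightedQuotientPiece w m 0 = Submodule.span K {1} := by
      apply le_antisymm
      · rintro _ ⟨p, -, rfl⟩
        refine Submodule.mem_span_singleton.2 ⟨constantCoeff p, ?_⟩
        have hp : C (constantCoeff p) - p ∈ m := by
          rw [RingHom.mem_ker, map_sub, constantCoeff_C, sub_self]
        rw [Algebra.smul_def, mul_one]
        exact (Ideal.Quotient.mk_eq_mk_iff_sub_mem _ _).2 hp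
      · rw [Submodule.span_singleton_le_iff_mem]
        exact mk_mem_weightedQuotientPiece m (isWeightedHomogeneous_one K w)
    rw [hspan, finrank_span_singleton one_ne_zero, Nat.cast_one]
  · have hbot : weightedQuotientPiece w m k = ⊥ := by
      rw [eq_bot_iff]
      rintro _ ⟨p, hp, rfl⟩
      exact Ideal.Quotient.eq_zero_iff_mem.2
        (RingHom.mem_ker.2 (IsWeightedHomogeneous.coeff_eq_zero hp 0 (by simpa using Ne.symm hk)))
    rw [hbot, finrank_bot, Nat.cast_zero]

open RingTheory.Sequence in
/-- The Hilbert series of `K[x] ⧸ (g₁, …, gᵣ)` for homogeneous `gᵢ` that form a weakly regular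
sequence in the localization at the origin. -/
theorem weightedHilbertSeries_ofList [Finite σ] {w : σ → ℕ} (hw : ∀ i, w i ≠ 0)
    (L : List (ℕ × MvPolynomial σ K)) :
    (∀ p ∈ L, IsWeightedHomogeneous w p.2 p.1) →
    IsWeaklyRegular
      (Localization.AtPrime (RingHom.ker (constantCoeff : MvPolynomial σ K →+* K)))
      (L.map fun p => algebraMap (MvPolynomial σ K)
        (Localization.AtPrime (RingHom.ker (constantCoeff : MvPolynomial σ K →+* K))) p.2) →
    weightedHilbertSeries w (Ideal.ofList (L.map Prod.snd)) =
      (L.map fun p => 1 - (PowerSeries.X : PowerSeries ℤ) ^ p.1).prod *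
        weightedHilbertSeries w (⊥ : Ideal (MvPolynomial σ K)) := by
  induction L using List.reverseRecOn with
  | nil => intros; simp
  | append_singleton L p ih =>
    intro hL hreg
    rw [List.map_append, isWeaklyRegular_append_iff, List.map_singleton,
      isWeaklyRegular_singleton_iff, isSMulRegular_quotient_iff_mem_of_smul_mem] at hreg
    have hL' : ∀ q ∈ L, IsWeightedHomogeneous w q.2 q.1 := fun q hq => hL q (by simp [hq])
    have hI : ∀ q ∈ Ideal.ofList (L.map Prod.snd), ∀ k,
        weightedHomogeneousComponent w k q ∈ Ideal.ofList (L.map Prod.snd) := by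
      intro q hq k
      refine weightedHomogeneousComponent_mem_span ?_ hq k
      intro g hg
      obtain ⟨a, ha, rfl⟩ := List.mem_map.1 hg
      exact ⟨_, hL' a ha⟩
    have hmap : Ideal.ofList (L.map fun p => algebraMap (MvPolynomial σ K)
        (Localization.AtPrime (RingHom.ker (constantCoeff : MvPolynomial σ K →+* K))) p.2) =
        (Ideal.ofList (L.map Prod.snd)).map (algebraMap _ _) := by
      rw [Ideal.map_ofList, List.map_map]
      rfl
    have hstep := weightedHilbertSeries_sup_span_singleton hw hI (hL p (by simp)) (by
      intro k h hh hmem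
      have h1 := hreg.2 (algebraMap _ _ h) (by
        rw [hmap, smul_eq_mul, smul_eq_mul, Ideal.mul_top, ← map_mul]
        exact Ideal.mem_map_of_mem _ hmem)
      rw [hmap, smul_eq_mul, Ideal.mul_top, IsLocalization.algebraMap_mem_map_algebraMap_iff
        (RingHom.ker (constantCoeff : MvPolynomial σ K →+* K)).primeCompl] at h1
      obtain ⟨s, hs, hsh⟩ := h1
      have h2 := hI _ hsh k
      rw [mul_comm, weightedHomogeneousComponent_mul_of_isWeightedHomogeneous hh, if_pos le_rfl,
        Nat.sub_self, weightedHomogeneousComponent_zero _ hw] at h2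
      have hs' : coeff 0 s ≠ 0 := fun h0 => hs (RingHom.mem_ker.2 h0)
      have h3 := Ideal.mul_mem_right (C (coeff 0 s)⁻¹) _ h2
      rwa [mul_assoc, ← C_mul, mul_inv_cancel₀ hs', C_1, mul_one] at h3)
    rw [List.map_append, List.map_append, Ideal.ofList_append, List.prod_append,
      List.map_singleton, List.map_singleton, Ideal.ofList_singleton, hstep, ih hL' hreg.1,
      List.prod_singleton]
    ring

end HilbertSeries

section OriginLocalization

variable {K : Type*} [Field K] {n : ℕ}

open RingTheory.Sequence in
theorem MvPolynomial.isWeaklyRegular_ofFn_X :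
    IsWeaklyRegular (MvPolynomial (Fin n) K) (List.ofFn (X : Fin n → MvPolynomial (Fin n) K)) := by
  rw [isWeaklyRegular_iff]
  intro i hi
  have hi' : i < n := by simpa using hi
  have hset : Ideal.ofList ((List.ofFn (X : Fin n → MvPolynomial (Fin n) K)).take i) =
      Ideal.span (X '' {j : Fin n | (j : ℕ) < i}) := by
    unfold Ideal.ofList
    congr 1
    ext p
    simp only [Set.mem_ofPred_eq, List.mem_take_iff_getElem, List.getElem_ofFn, Set.mem_image,
      List.length_ofFn]
    constructor
    · rintro ⟨j, hj, rfl⟩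
      exact ⟨⟨j, by omega⟩, by simp only; omega, rfl⟩
    · rintro ⟨j, hj, rfl⟩
      exact ⟨j, by omega, rfl⟩
  rw [isSMulRegular_quotient_iff_mem_of_smul_mem, hset, smul_eq_mul, Ideal.mul_top,
    List.getElem_ofFn]
  intro p hp
  rw [mem_ideal_span_X_image] at hp ⊢
  intro m hm
  obtain ⟨j, hj, hmj⟩ := hp (Finsupp.single ⟨i, hi'⟩ 1 + m) (by
    rw [smul_eq_mul, mem_support_iff, coeff_X_mul]
    exact mem_support_iff.1 hm)
  refine ⟨j, hj, ?_⟩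
  have hne : (⟨i, hi'⟩ : Fin n) ≠ j := by
    rintro rfl
    exact lt_irrefl i hj
  simpa [Finsupp.single_apply, hne] using hmj

theorem MvPolynomial.ofList_ofFn_X :
    Ideal.ofList (List.ofFn (X : Fin n → MvPolynomial (Fin n) K)) =
      RingHom.ker (constantCoeff : MvPolynomial (Fin n) K →+* K) := by
  have h : {r | r ∈ List.ofFn (X : Fin n → MvPolynomial (Fin n) K)} = X '' Set.univ := by
    ext; simp
  ext p
  rw [Ideal.ofList, h, mem_ideal_span_X_image, RingHom.mem_ker, constantCoeff_eq]
  constructor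
  · intro hp
    by_contra h0
    obtain ⟨i, -, hi⟩ := hp 0 (mem_support_iff.2 h0)
    exact hi rfl
  · intro h0 m hm
    by_contra! hcon
    have : m = 0 := Finsupp.ext fun i => hcon i trivial
    exact mem_support_iff.1 hm (this ▸ h0)

open RingTheory.Sequence in
/-- `n` polynomials vanishing at the origin whose ideal contains a power of the maximal ideal at
the origin form a weakly regular sequence in the local ring at the origin. -/
theorem isWeaklyRegular_localization_of_ker_le_radical (g : Fin n → MvPolynomial (Fin n) K)
    (hg : ∀ i, constantCoeff (g i) = 0)
    (hrad : RingHom.ker (constantCoeff : MvPolynomial (Fin n) K →+* K) ≤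
      (Ideal.ofList (List.ofFn g)).radical) :
    IsWeaklyRegular
      (Localization.AtPrime (RingHom.ker (constantCoeff : MvPolynomial (Fin n) K →+* K)))
      ((List.ofFn g).map (algebraMap (MvPolynomial (Fin n) K)
        (Localization.AtPrime (RingHom.ker (constantCoeff : MvPolynomial (Fin n) K →+* K))))) := by
  set m := RingHom.ker (constantCoeff : MvPolynomial (Fin n) K →+* K)
  have hmem : ∀ h : Fin n → MvPolynomial (Fin n) K, (∀ i, constantCoeff (h i) = 0) →
      ∀ y ∈ (List.ofFn h).map (algebraMap _ (Localization.AtPrime m)),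
        y ∈ IsLocalRing.maximalIdeal (Localization.AtPrime m) := by
    intro h hh y hy
    obtain ⟨p, hp, rfl⟩ := List.mem_map.1 hy
    obtain ⟨i, rfl⟩ := List.mem_ofFn.1 hp
    rw [← Localization.AtPrime.map_eq_maximalIdeal]
    exact Ideal.mem_map_of_mem _ (RingHom.mem_ker.2 (hh i))
  have : IsNoetherianRing (Localization.AtPrime m) :=
    IsLocalization.isNoetherianRing m.primeCompl _ inferInstance
  refine IsLocalRing.isWeaklyRegular_of_maximalIdeal_le_radical _ _ _ (by simp)
    (hmem X (by simp)) (hmem g hg)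
    (isWeaklyRegular_ofFn_X.of_isLocalization (Localization.AtPrime m) m.primeCompl) ?_
  rw [← Localization.AtPrime.map_eq_maximalIdeal, ← Ideal.map_ofList]
  exact (Ideal.map_mono hrad).trans ((Ideal.map_radical_le _).trans
    (Ideal.radical_mono le_sup_left))

end OriginLocalization

section FiniteQuotient

variable {K σ : Type*} [Field K]

/-- A finite-dimensional quotient by a homogeneous ideal vanishes in all large degrees. -/
theorem exists_forall_isWeightedHomogeneous_mem (w : σ → ℕ) {I : Ideal (MvPolynomial σ K)}
    (hI : ∀ p ∈ I, ∀ k, weightedHomogeneousComponent w k p ∈ I)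
    [FiniteDimensional K (MvPolynomial σ K ⧸ I)] :
    ∃ N, ∀ k ≥ N, ∀ p, IsWeightedHomogeneous w p k → p ∈ I := by
  set T := {k | ∃ p, IsWeightedHomogeneous w p k ∧ p ∉ I}
  have hT : ∀ k : T, ∃ p : MvPolynomial σ K, IsWeightedHomogeneous w p k ∧ p ∉ I := fun k => k.2
  choose p hp hpI using hT
  have hli : LinearIndependent K fun k : T => Ideal.Quotient.mk I (p k) := by
    classical
    rw [linearIndependent_iff']
    intro s c hc k hk
    have hmem : ∑ j ∈ s, c j • p j ∈ I := by
      rw [← Ideal.Quotient.eq_zero_iff_mem, map_sum]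
      exact hc
    have hcomp := hI _ hmem k
    rw [map_sum, Finset.sum_eq_single_of_mem k hk, map_smul,
      (hp k).weightedHomogeneousComponent_same] at hcomp
    · by_contra hck
      exact hpI k ((Submodule.smul_mem_iff (I.restrictScalars K) hck).1 hcomp)
    · intro j _ hjk
      rw [map_smul, (hp j).weightedHomogeneousComponent_ne _ (fun h => hjk (Subtype.ext h.symm)),
        smul_zero]
  have hfin : T.Finite := Set.finite_coe_iff.1 hli.finite
  obtain ⟨N, hN⟩ := hfin.bddAbove
  refine ⟨N + 1, fun k hk q hq => ?_⟩
  by_contra hqI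
  have := hN (show k ∈ T from ⟨q, hq, hqI⟩)
  omega

end FiniteQuotient

/-- A power series identity `H * ∏ (1 - X ^ wᵢ) = ∏ (1 - X ^ eᵢ)` with `H` a polynomial forces the
coefficient of `H` in degree `∑ eᵢ - ∑ wᵢ` to be `1`. -/
theorem PowerSeries.coeff_eq_one_of_mul_prod_eq_prod {ι : Type*} (s : Finset ι) {w e : ι → ℕ}
    (hw : ∀ i ∈ s, 0 < w i) (he : ∀ i ∈ s, 0 < e i) (H : PowerSeries ℤ) (N : ℕ)
    (hN : ∀ k ≥ N, PowerSeries.coeff k H = 0)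
    (h : H * ∏ i ∈ s, (1 - PowerSeries.X ^ w i) = ∏ i ∈ s, (1 - PowerSeries.X ^ e i)) :
    PowerSeries.coeff (∑ i ∈ s, e i - ∑ i ∈ s, w i) H = 1 := by
  set P : Polynomial ℤ := PowerSeries.trunc N H
  have hP : (P : PowerSeries ℤ) = H := by
    ext k
    rw [Polynomial.coeff_coe, PowerSeries.coeff_trunc]
    split_ifs with hk
    · rfl
    · exact (hN k (not_lt.1 hk)).symm
  have hneg : H * ∏ i ∈ s, (PowerSeries.X ^ w i - 1) = ∏ i ∈ s, (PowerSeries.X ^ e i - 1) := by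
    have hflip : ∀ a : ι → ℕ, ∏ i ∈ s, ((PowerSeries.X : PowerSeries ℤ) ^ a i - 1) =
        (-1) ^ s.card * ∏ i ∈ s, (1 - PowerSeries.X ^ a i) := fun a => by
      rw [← Finset.prod_const, ← Finset.prod_mul_distrib]
      exact Finset.prod_congr rfl fun i _ => by ring
    rw [hflip, hflip, ← h]
    ring
  have hpoly : P * ∏ i ∈ s, (Polynomial.X ^ w i - 1) = ∏ i ∈ s, (Polynomial.X ^ e i - 1) := by
    apply Polynomial.coe_injective ℤ
    have hcoe : ∀ a : ι → ℕ, ((∏ i ∈ s, (Polynomial.X ^ a i - 1) : Polynomial ℤ) :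
        PowerSeries ℤ) = ∏ i ∈ s, (PowerSeries.X ^ a i - 1) := fun a => by
      rw [← Polynomial.coeToPowerSeries.ringHom_apply, map_prod]
      simp
    rw [Polynomial.coe_mul, hcoe, hcoe, hP, hneg]
  have hmonic : ∀ a : ι → ℕ, (∀ i ∈ s, 0 < a i) →
      (∏ i ∈ s, (Polynomial.X ^ a i - 1) : Polynomial ℤ).Monic ∧
      (∏ i ∈ s, (Polynomial.X ^ a i - 1) : Polynomial ℤ).natDegree = ∑ i ∈ s, a i := by
    intro a ha
    have hm : ∀ i ∈ s, (Polynomial.X ^ a i - 1 : Polynomial ℤ).Monic := fun i hi =>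
      Polynomial.monic_X_pow_sub_C 1 (ha i hi).ne'
    refine ⟨Polynomial.monic_prod_of_monic _ _ hm, ?_⟩
    rw [Polynomial.natDegree_prod_of_monic _ _ hm]
    exact Finset.sum_congr rfl fun i _ => Polynomial.natDegree_X_pow_sub_C (r := (1 : ℤ))
  obtain ⟨hWm, hWd⟩ := hmonic w hw
  obtain ⟨hEm, hEd⟩ := hmonic e he
  have hPm : P.Monic := hWm.of_mul_monic_right (hpoly ▸ hEm)
  have hdeg := congrArg Polynomial.natDegree hpoly
  rw [hPm.natDegree_mul hWm, hWd, hEd] at hdeg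
  rw [← hP, Polynomial.coeff_coe, ← hdeg, Nat.add_sub_cancel]
  exact hPm

/-- The Hilbert series of a quotient of `K[x₁, …, xₙ]` by `n` homogeneous polynomials of degrees
`eᵢ > 0` is `∏ (1 - X ^ eᵢ) / ∏ (1 - X ^ wᵢ)` when the quotient is finite-dimensional. -/
theorem weightedHilbertSeries_mul_prod {K : Type*} [Field K] {n : ℕ} {w e : Fin n → ℕ}
    (hw : ∀ i, w i ≠ 0) (he : ∀ i, e i ≠ 0) (g : Fin n → MvPolynomial (Fin n) K)
    (hg : ∀ i, IsWeightedHomogeneous w (g i) (e i))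
    [FiniteDimensional K (MvPolynomial (Fin n) K ⧸ Ideal.span (Set.range g))] :
    weightedHilbertSeries w (Ideal.span (Set.range g)) * ∏ i, (1 - PowerSeries.X ^ w i) =
      ∏ i, (1 - PowerSeries.X ^ e i) := by
  have hspan : ∀ h : Fin n → MvPolynomial (Fin n) K,
      Ideal.ofList (List.ofFn h) = Ideal.span (Set.range h) := fun h => by
    rw [Ideal.ofList]
    congr 1
    ext p
    exact List.mem_ofFn
  have hconst : ∀ (h : Fin n → MvPolynomial (Fin n) K) (a : Fin n → ℕ), (∀ i, a i ≠ 0) →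
      (∀ i, IsWeightedHomogeneous w (h i) (a i)) → ∀ i, constantCoeff (h i) = 0 := by
    intro h a ha hh i
    exact (hh i).coeff_eq_zero 0 (by simpa using (ha i).symm)
  have key : ∀ (h : Fin n → MvPolynomial (Fin n) K) (a : Fin n → ℕ), (∀ i, a i ≠ 0) →
      (∀ i, IsWeightedHomogeneous w (h i) (a i)) →
      RingHom.ker (constantCoeff : MvPolynomial (Fin n) K →+* K) ≤
        (Ideal.ofList (List.ofFn h)).radical →
      weightedHilbertSeries w (Ideal.ofList (List.ofFn h)) =
        (∏ i, (1 - PowerSeries.X ^ a i)) *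
          weightedHilbertSeries w (⊥ : Ideal (MvPolynomial (Fin n) K)) := by
    intro h a ha hh hrad
    have := weightedHilbertSeries_ofList hw (List.ofFn fun i => (a i, h i))
      (by
        intro p hp
        obtain ⟨i, rfl⟩ := List.mem_ofFn.1 hp
        exact hh i)
      (by
        have := isWeaklyRegular_localization_of_ker_le_radical h (hconst h a ha hh) hrad
        rw [List.map_ofFn] at this ⊢
        exact this)
    rw [List.map_ofFn, List.map_ofFn, List.prod_ofFn] at this
    exact this
  have hX := key X w hw (fun i => isWeightedHomogeneous_X K w i)
    (ofList_ofFn_X.ge.trans Ideal.le_radical)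
  have hX_one : weightedHilbertSeries w (RingHom.ker
      (constantCoeff : MvPolynomial (Fin n) K →+* K)) = 1 :=
    weightedHilbertSeries_ker_constantCoeff w
  have hrad : RingHom.ker (constantCoeff : MvPolynomial (Fin n) K →+* K) ≤
      (Ideal.ofList (List.ofFn g)).radical := by
    obtain ⟨N, hN⟩ := exists_forall_isWeightedHomogeneous_mem w
      (I := Ideal.span (Set.range g)) (fun p hp k => weightedHomogeneousComponent_mem_span
        (by rintro _ ⟨i, rfl⟩; exact ⟨_, hg i⟩) hp k)
    rw [← ofList_ofFn_X, hspan, hspan, Ideal.span_le]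
    rintro _ ⟨i, rfl⟩
    exact ⟨N, hN (N • w i) (Nat.le_mul_of_pos_right N (Nat.pos_of_ne_zero (hw i))) _
      ((isWeightedHomogeneous_X K w i).pow N)⟩
  have hQ := key g e he hg hrad
  rw [ofList_ofFn_X, hX_one] at hX
  rw [← hspan, hQ, mul_assoc, mul_comm (weightedHilbertSeries w _), ← hX, mul_one]

/-- For a weighted homogeneous polynomial `f` of degree `d` (weights `w i`,
`2 w i ≤ d`) with an isolated singularity at `0`, the top graded piece of the Milnor algebra
is one-dimensional: `dim_ℂ Q_{n·d − 2·Σᵢ wᵢ} = 1`.  In particular there is a weighted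
homogeneous polynomial of degree `n·d − 2·Σᵢ wᵢ` not lying in the Jacobian ideal. -/
theorem stmt5 (n : ℕ) (hn : 1 ≤ n) (d : ℕ) (w : Fin n → ℕ)
    (hd : 0 < d) (hw : ∀ i, 0 < w i) (hwd : ∀ i, 2 * w i ≤ d)
    (f : MvPolynomial (Fin n) ℂ)
    (hf : MvPolynomial.IsWeightedHomogeneous w f d)
    (hiso : FiniteDimensional ℂ (MvPolynomial (Fin n) ℂ ⧸ jacobianIdeal n f)) :
    Module.finrank ℂ (milnorPiece n w f (n * d - 2 * ∑ i, w i)) = 1 ∧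
    ∃ g : MvPolynomial (Fin n) ℂ,
      MvPolynomial.IsWeightedHomogeneous w g (n * d - 2 * ∑ i, w i) ∧
      g ∉ jacobianIdeal n f := by
  have hle : ∀ i, w i ≤ d := fun i => by have := hwd i; omega
  have hpos : ∀ i, 0 < d - w i := fun i => by have := hwd i; have := hw i; omega
  have hhom : ∀ i, IsWeightedHomogeneous w (pderiv i f) (d - w i) :=
    fun i => hf.pderiv (Nat.sub_add_cancel (hle i))
  have hcomp : ∀ p ∈ jacobianIdeal n f, ∀ k,
      weightedHomogeneousComponent w k p ∈ jacobianIdeal n f :=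
    fun p hp k => weightedHomogeneousComponent_mem_span
      (by rintro _ ⟨i, rfl⟩; exact ⟨_, hhom i⟩) hp k
  obtain ⟨N, hN⟩ := exists_forall_isWeightedHomogeneous_mem w hcomp
  have hzero : ∀ k ≥ N, PowerSeries.coeff k (weightedHilbertSeries w (jacobianIdeal n f)) = 0 := by
    intro k hk
    have hbot : weightedQuotientPiece w (jacobianIdeal n f) k = ⊥ := by
      rw [eq_bot_iff]
      rintro _ ⟨p, hp, rfl⟩
      exact Ideal.Quotient.eq_zero_iff_mem.2 (hN k hk p hp)
    rw [weightedHilbertSeries, PowerSeries.coeff_mk, hbot, finrank_bot, Nat.cast_zero]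
  have : FiniteDimensional ℂ
      (MvPolynomial (Fin n) ℂ ⧸ Ideal.span (Set.range fun i => pderiv i f)) := hiso
  have hcoeff := PowerSeries.coeff_eq_one_of_mul_prod_eq_prod Finset.univ (fun i _ => hw i)
    (fun i _ => hpos i) _ N hzero
    (weightedHilbertSeries_mul_prod (fun i => (hw i).ne') (fun i => (hpos i).ne') _ hhom)
  have hdeg : ∑ i, (d - w i) - ∑ i, w i = n * d - 2 * ∑ i, w i := by
    rw [Finset.sum_tsub_distrib _ fun i _ => hle i, Finset.sum_const, Finset.card_univ,
      Fintype.card_fin, smul_eq_mul, Nat.sub_sub, two_mul]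
  rw [hdeg, weightedHilbertSeries, PowerSeries.coeff_mk] at hcoeff
  have hone : Module.finrank ℂ (milnorPiece n w f (n * d - 2 * ∑ i, w i)) = 1 := by
    exact_mod_cast hcoeff
  refine ⟨hone, ?_⟩
  by_contra! hcon
  have hbot : milnorPiece n w f (n * d - 2 * ∑ i, w i) = ⊥ := by
    rw [eq_bot_iff]
    rintro _ ⟨p, hp, rfl⟩
    exact Ideal.Quotient.eq_zero_iff_mem.2 (hcon p hp)
  rw [hbot, finrank_bot] at hone
  exact zero_ne_one hone
end
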